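/- Let Ω := (𝔻 ∪ 𝔻₁(3/2)) ∖ {3/2}, let r_u : 𝔻 → Ω be the universal covering, and let r̂_u ∈ C(𝔐(H^∞(𝔻))) be the Gelfand extension of r_u ∈ H^∞(𝔻); set Ṽ := {ξ ∈ 𝔐(H^∞(𝔻)) : Re r̂_u(ξ) ≤ 1/2}. Let p : 𝔻 × ℤ → 𝔻 be the projection (z, n) ↦ z, and p̂ : 𝔐(H^∞(𝔻 × ℤ)) → 𝔻̄ its Gelfand extension. Set S := {z ∈ 𝔻̄ : Re z ≤ 1/2} and S_o := {z ∈ 𝔻̄ : Re z ≥ −1/2}. Then p̂⁻¹(S) and p̂⁻¹(S_o) are each homeomorphic to the compact set Ṽ ⊂ 𝔐(H^∞(𝔻)), and 𝔐(H^∞(𝔻 × ℤ)) = p̂⁻¹(S) ∪ p̂⁻¹(S_o). -/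

import Mathlib

open Set Metric WeakDual BoundedContinuousFunction Manifold Topology Complex

set_option synthInstance.maxHeartbeats 1000000
set_option maxHeartbeats 2000000

noncomputable section

/-- The covering dimension of a topological space `X` is at most `n`: every open cover
has an open refinement of order at most `n + 1`. -/
def CovDimLE (X : Type) [TopologicalSpace X] (n : ℕ) : Prop :=
  ∀ 𝒰 : Set (Set X), (∀ U ∈ 𝒰, IsOpen U) → ⋃₀ 𝒰 = Set.univ →
    ∃ 𝒱 : Set (Set X), (∀ V ∈ 𝒱, IsOpen V) ∧ ⋃₀ 𝒱 = Set.univ ∧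
      (∀ V ∈ 𝒱, ∃ U ∈ 𝒰, V ⊆ U) ∧
      ∀ x : X, {V ∈ 𝒱 | x ∈ V}.Finite ∧ {V ∈ 𝒱 | x ∈ V}.ncard ≤ n + 1

/-- `dim X = n`: the covering dimension of `X` is at most `n` but not at most `n - 1`. -/
def CovDimEq (X : Type) [TopologicalSpace X] (n : ℕ) : Prop :=
  CovDimLE X n ∧ ¬ CovDimLE X (n - 1)

/-- A Čech 2-cocycle (with coefficients in `ℤ`) on the open cover `U` of `X`. -/
def IsCechTwoCocycle {X : Type} [TopologicalSpace X] {ι : Type}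
    (U : ι → Set X) (c : ι → ι → ι → ℤ) : Prop :=
  ∀ i j k l : ι, (U i ∩ U j ∩ U k ∩ U l).Nonempty →
    c j k l - c i k l + c i j l - c i j k = 0

/-- Triviality of the second Čech cohomology group `H²(X, ℤ)`: every integral 2-cocycle on
every open cover of `X` becomes a coboundary after passing to a suitable open refinement. -/
def CechH2Trivial (X : Type) [TopologicalSpace X] : Prop :=
  ∀ (ι : Type) (U : ι → Set X), (∀ i, IsOpen (U i)) → (⋃ i, U i) = Set.univ →
    ∀ c : ι → ι → ι → ℤ, IsCechTwoCocycle U c →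
      ∃ (κ : Type) (V : κ → Set X) (τ : κ → ι),
        (∀ j, IsOpen (V j)) ∧ (⋃ j, V j) = Set.univ ∧ (∀ j, V j ⊆ U (τ j)) ∧
        ∃ b : κ → κ → ℤ, ∀ i j k : κ, (V i ∩ V j ∩ V k).Nonempty →
          c (τ i) (τ j) (τ k) = b j k - b i k + b i j

/-- The Banach algebra `H^∞(D)` of bounded holomorphic functions on a set `D ⊆ ℂ`,
realized as a subalgebra of the bounded continuous functions on `D`. -/
def Hinf (D : Set ℂ) : Subalgebra ℂ (D →ᵇ ℂ) where
  carrier := {f | ∃ g : ℂ → ℂ, DifferentiableOn ℂ g D ∧ ∀ z : D, f z = g z}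
  add_mem' := by
    rintro f g ⟨F, hF, hfF⟩ ⟨G, hG, hgG⟩
    exact ⟨F + G, hF.add hG, fun z => by simp [hfF z, hgG z]⟩
  mul_mem' := by
    rintro f g ⟨F, hF, hfF⟩ ⟨G, hG, hgG⟩
    exact ⟨F * G, hF.mul hG, fun z => by simp [hfF z, hgG z]⟩
  algebraMap_mem' := fun c =>
    ⟨fun _ => c, differentiableOn_const c, fun _ => rfl⟩

/-- The maximal ideal space `𝔐(H^∞(D))` of `H^∞(D)`. -/
abbrev MaxIdealSpace (D : Set ℂ) := characterSpace ℂ (Hinf D)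

/-- Evaluation at a point of `D`, as a continuous linear functional on `H^∞(D)`. -/
def HinfEvalCLM (D : Set ℂ) (z : D) : Hinf D →L[ℂ] ℂ :=
  (BoundedContinuousFunction.evalCLM ℂ z).comp
    (Subalgebra.toSubmodule (Hinf D)).subtypeL

lemma HinfEvalCLM_apply (D : Set ℂ) (z : D) (f : Hinf D) :
    HinfEvalCLM D z f = (f : D →ᵇ ℂ) z := rfl

/-- Evaluation at a point of `D`, as an element of the maximal ideal space of `H^∞(D)`.
This realizes `D` as a subset of `𝔐(H^∞(D))`. -/
def evalChar (D : Set ℂ) (z : D) : MaxIdealSpace D :=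
  ⟨HinfEvalCLM D z, by
    constructor
    · intro h
      have h1 : HinfEvalCLM D z 1 = 0 := by rw [h]; rfl
      rw [HinfEvalCLM_apply] at h1
      have h2 : ((1 : Hinf D) : D →ᵇ ℂ) z = (1 : ℂ) := rfl
      rw [h2] at h1
      exact one_ne_zero h1
    · intro f g
      rfl⟩

/-- The open unit disk in `ℂ`. -/
abbrev unitDisk : Set ℂ := ball (0 : ℂ) 1

/-- The domain `Ω := (𝔻 ∪ 𝔻₁(3/2)) \ {3/2}`. -/
def Omega : Set ℂ := (ball (0 : ℂ) 1 ∪ ball ((3 : ℂ) / 2) 1) \ {(3 : ℂ) / 2}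

/-- `𝔻 × ℤ`: the disjoint union of copies of the open unit disk indexed by `ℤ`. -/
abbrev DiskInt := unitDisk × ℤ

/-- The Banach algebra `H^∞(𝔻 × ℤ)`. -/
def HinfDiskInt : Subalgebra ℂ (DiskInt →ᵇ ℂ) where
  carrier := {f | ∀ n : ℤ, ∃ g : ℂ → ℂ, DifferentiableOn ℂ g unitDisk ∧
    ∀ z : unitDisk, f (z, n) = g z}
  add_mem' := by
    rintro f g hf hg n
    obtain ⟨F, hF, hfF⟩ := hf n
    obtain ⟨G, hG, hgG⟩ := hg n
    exact ⟨F + G, hF.add hG, fun z => by simp [hfF z, hgG z]⟩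
  mul_mem' := by
    rintro f g hf hg n
    obtain ⟨F, hF, hfF⟩ := hf n
    obtain ⟨G, hG, hgG⟩ := hg n
    exact ⟨F * G, hF.mul hG, fun z => by simp [hfF z, hgG z]⟩
  algebraMap_mem' := fun c n =>
    ⟨fun _ => c, differentiableOn_const c, fun _ => rfl⟩

/-- The Cauchy transform of a density `c` on the horizontal line `Im = y`. -/
def lineCauchy (c : ℝ → ℂ) (y : ℝ) (v : ℂ) : ℂ :=
  ∫ x : ℝ, c x / ((x : ℂ) + y * I - v)

section LineCauchy
open MeasureTheory

lemma le_norm_line_sub {a y : ℝ} {v : ℂ} (hv : a ≤ |v.im - y|) (x : ℝ) :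
    a ≤ ‖(x : ℂ) + y * I - v‖ := by
  refine hv.trans ?_
  have := Complex.abs_im_le_norm ((x : ℂ) + y * I - v)
  simp only [sub_im, add_im, ofReal_im, mul_im, ofReal_re, I_im, mul_one, I_re, mul_zero,
    add_zero, zero_add] at this
  rwa [abs_sub_comm] at this

lemma line_sub_ne_zero {a y : ℝ} (ha : 0 < a) {v : ℂ} (hv : a ≤ |v.im - y|) (x : ℝ) :
    (x : ℂ) + y * I - v ≠ 0 :=
  norm_pos_iff.mp (ha.trans_le (le_norm_line_sub hv x))

lemma integrable_lineCauchy {c : ℝ → ℂ} (hc : Integrable c) {a y : ℝ} (ha : 0 < a) {v : ℂ}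
    (hv : a ≤ |v.im - y|) : Integrable fun x : ℝ => c x / ((x : ℂ) + y * I - v) := by
  simp_rw [div_eq_mul_inv]
  refine hc.mul_bdd (c := a⁻¹) ?_ (Filter.Eventually.of_forall fun x => ?_)
  · refine (Continuous.inv₀ (by fun_prop) (line_sub_ne_zero ha hv)).aestronglyMeasurable
  · rw [norm_inv]
    exact inv_anti₀ ha (le_norm_line_sub hv x)

lemma norm_lineCauchy_le {c : ℝ → ℂ} (hc : Integrable c) {a y : ℝ} (ha : 0 < a) {v : ℂ}
    (hv : a ≤ |v.im - y|) : ‖lineCauchy c y v‖ ≤ (∫ x, ‖c x‖) / a := by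
  rw [← integral_div]
  refine norm_integral_le_of_norm_le (hc.norm.div_const a)
    (Filter.Eventually.of_forall fun x => ?_)
  rw [norm_div]
  exact div_le_div_of_nonneg_left (norm_nonneg _) ha (le_norm_line_sub hv x)

lemma norm_lineCauchy_sub_le {c : ℝ → ℂ} (hc : Integrable c) {a y : ℝ} (ha : 0 < a) {v w : ℂ}
    (hv : a ≤ |v.im - y|) (hw : a ≤ |w.im - y|) :
    ‖lineCauchy c y v - lineCauchy c y w‖ ≤ (∫ x, ‖c x‖) / a ^ 2 * ‖v - w‖ := by
  rw [lineCauchy, lineCauchy, ← integral_sub (integrable_lineCauchy hc ha hv)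
    (integrable_lineCauchy hc ha hw), ← integral_div, ← integral_mul_const]
  refine norm_integral_le_of_norm_le ((hc.norm.div_const _).mul_const _)
    (Filter.Eventually.of_forall fun x => ?_)
  have h1 := line_sub_ne_zero ha hv x
  have h2 := line_sub_ne_zero ha hw x
  have : c x / ((x : ℂ) + y * I - v) - c x / ((x : ℂ) + y * I - w)
      = c x / (((x : ℂ) + y * I - v) * ((x : ℂ) + y * I - w)) * (v - w) := by
    field_simp
    ring
  rw [this, norm_mul, norm_div, norm_mul, sq]
  have := le_norm_line_sub hv x
  have := le_norm_line_sub hw x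
  gcongr

lemma differentiableAt_lineCauchy {c : ℝ → ℂ} (hc : Integrable c) {y : ℝ} {v : ℂ}
    (hv : v.im ≠ y) : DifferentiableAt ℂ (lineCauchy c y) v := by
  set a := |v.im - y| / 2 with ha_def
  have ha : 0 < a := by have := abs_pos.mpr (sub_ne_zero.mpr hv); positivity
  have hball : ∀ w ∈ ball v a, a ≤ |w.im - y| := by
    intro w hw
    have h1 := (Complex.abs_im_le_norm (w - v)).trans_lt (mem_ball_iff_norm.mp hw)
    rw [sub_im] at h1
    have h2 : |v.im - y| ≤ |w.im - y| + |w.im - v.im| := by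
      have := abs_sub_le v.im w.im y
      rw [abs_sub_comm v.im w.im] at this
      linarith
    linarith
  refine (hasDerivAt_integral_of_dominated_loc_of_deriv_le (μ := volume)
    (F := fun (w : ℂ) (x : ℝ) => c x / ((x : ℂ) + y * I - w))
    (F' := fun (w : ℂ) (x : ℝ) => c x / ((x : ℂ) + y * I - w) ^ 2)
    (bound := fun x => ‖c x‖ / a ^ 2) (ball_mem_nhds v ha) ?_ ?_ ?_ ?_ ?_ ?_).2.differentiableAt
  · filter_upwards [ball_mem_nhds v ha] with w hw
    exact (integrable_lineCauchy hc ha (hball w hw)).aestronglyMeasurable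
  · exact integrable_lineCauchy hc ha (hball v (mem_ball_self ha))
  · simp_rw [div_eq_mul_inv]
    refine hc.aestronglyMeasurable.mul
      (Continuous.inv₀ (by fun_prop) fun x => ?_).aestronglyMeasurable
    exact pow_ne_zero _ (line_sub_ne_zero ha (hball v (mem_ball_self ha)) x)
  · refine Filter.Eventually.of_forall fun x w hw => ?_
    rw [norm_div, norm_pow]
    have := le_norm_line_sub (hball w hw) x
    gcongr
  · exact hc.norm.div_const _
  · refine Filter.Eventually.of_forall fun x w hw => ?_
    have h := line_sub_ne_zero ha (hball w hw) x
    have := ((hasDerivAt_const w (c x)).div ((hasDerivAt_id w).const_sub ((x : ℂ) + y * I)) h)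
    exact this.congr_deriv (by simp)

end LineCauchy

section StripCauchy
open MeasureTheory Filter

lemma integral_inv_line {s : ℝ} (hs : s ≠ 0) (R : ℝ) :
    ∫ x in (-R)..R, ((x : ℂ) + s * I)⁻¹ = -(2 * Real.arctan (R / s) : ℝ) * I := by
  have hne : ∀ x : ℝ, (x : ℂ) + s * I ≠ 0 := fun x h => hs (by simpa using congrArg Complex.im h)
  have hpos : ∀ x : ℝ, 0 < x ^ 2 + s ^ 2 := fun x => by positivity
  have hd : ∀ x : ℝ, HasDerivAt
      (fun x : ℝ => ((1 / 2 * Real.log (x ^ 2 + s ^ 2) : ℝ) : ℂ) - (Real.arctan (x / s) : ℝ) * I)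
      (((x : ℂ) + s * I)⁻¹) x := by
    intro x
    have h1 : HasDerivAt (fun x : ℝ => 1 / 2 * Real.log (x ^ 2 + s ^ 2))
        (1 / 2 * ((2 * x) / (x ^ 2 + s ^ 2))) x := by
      have := (((hasDerivAt_pow 2 x).add_const (s ^ 2)).log (hpos x).ne').const_mul (1 / 2)
      simpa using this
    have h2 : HasDerivAt (fun x : ℝ => Real.arctan (x / s)) (1 / (1 + (x / s) ^ 2) * (1 / s)) x :=
      ((hasDerivAt_id x).div_const s).arctan
    have h3 := h1.ofReal_comp.sub ((h2.ofReal_comp).mul_const I)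
    refine h3.congr_deriv ?_
    have e1 : 1 / (1 + (x / s) ^ 2) * (1 / s) = s / (x ^ 2 + s ^ 2) := by
      field_simp
      ring
    have e2 : ((x : ℂ) ^ 2 + s ^ 2) ≠ 0 := by exact_mod_cast (hpos x).ne'
    have hx := hne x
    rw [e1]
    push_cast
    field_simp
    ring_nf
    rw [I_sq]
    ring
  rw [intervalIntegral.integral_eq_sub_of_hasDerivAt (fun x _ => hd x)
    ((Continuous.inv₀ (by fun_prop) hne).intervalIntegrable _ _)]
  simp only [neg_sq, neg_div, Real.arctan_neg]
  push_cast
  ring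

lemma tendsto_integral_inv_line_pos {s : ℝ} (hs : 0 < s) :
    Tendsto (fun R : ℝ => ∫ x in (-R)..R, ((x : ℂ) + s * I)⁻¹) atTop (𝓝 (-(Real.pi : ℂ) * I)) := by
  simp_rw [integral_inv_line hs.ne']
  have h1 : Tendsto (fun R : ℝ => Real.arctan (R / s)) atTop (𝓝 (Real.pi / 2)) :=
    (tendsto_nhds_of_tendsto_nhdsWithin Real.tendsto_arctan_atTop).comp
      (tendsto_id.atTop_div_const hs)
  have h2 := (Complex.continuous_ofReal.tendsto _).comp (h1.const_mul 2)
  have := (h2.neg).mul_const I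
  convert this using 2
  · simp
  · push_cast
    ring

lemma tendsto_integral_inv_line_neg {s : ℝ} (hs : s < 0) :
    Tendsto (fun R : ℝ => ∫ x in (-R)..R, ((x : ℂ) + s * I)⁻¹) atTop (𝓝 ((Real.pi : ℂ) * I)) := by
  simp_rw [integral_inv_line hs.ne]
  have h1 : Tendsto (fun R : ℝ => Real.arctan (R / s)) atTop (𝓝 (-(Real.pi / 2))) :=
    (tendsto_nhds_of_tendsto_nhdsWithin Real.tendsto_arctan_atBot).comp
      (tendsto_id.atTop_div_const_of_neg hs)
  have h2 := (Complex.continuous_ofReal.tendsto _).comp (h1.const_mul 2)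
  have := (h2.neg).mul_const I
  convert this using 2
  · simp
  · push_cast
    ring

lemma tendsto_integral_line_dslope {h : ℂ → ℂ} {y : ℝ} {v : ℂ} (hy : v.im ≠ y)
    (hint : Integrable fun x : ℝ => h (x + y * I)) {L : ℂ}
    (hL : Tendsto (fun R : ℝ => ∫ x in (-R)..R, ((x : ℂ) + (y - v.im : ℝ) * I)⁻¹) atTop (𝓝 L)) :
    Tendsto (fun R : ℝ => ∫ x in (v.re - R)..(v.re + R), dslope h v (x + y * I)) atTop
      (𝓝 (lineCauchy (fun x => h (x + y * I)) y v - h v * L)) := by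
  have ha : 0 < |v.im - y| := abs_pos.mpr (sub_ne_zero.mpr hy)
  have hint' := integrable_lineCauchy hint ha le_rfl
  have hne := fun x => line_sub_ne_zero ha le_rfl (v := v) (y := y) x
  have hcont : Continuous fun x : ℝ => h v * ((x : ℂ) + y * I - v)⁻¹ :=
    continuous_const.mul (Continuous.inv₀ (by fun_prop) hne)
  have key : ∀ R : ℝ, ∫ x in (v.re - R)..(v.re + R), dslope h v (x + y * I) =
      (∫ x in (v.re - R)..(v.re + R), h (x + y * I) / ((x : ℂ) + y * I - v)) -
        h v * ∫ x in (-R)..R, ((x : ℂ) + (y - v.im : ℝ) * I)⁻¹ := by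
    intro R
    have e : ∫ x in (-R)..R, ((x : ℂ) + (y - v.im : ℝ) * I)⁻¹ =
        ∫ x in (v.re - R)..(v.re + R), ((x : ℂ) + y * I - v)⁻¹ := by
      have := intervalIntegral.integral_comp_add_right (a := -R) (b := R)
        (fun x : ℝ => ((x : ℂ) + y * I - v)⁻¹) v.re
      rw [show v.re - R = -R + v.re by ring, show v.re + R = R + v.re by ring, ← this]
      congr 1
      ext x
      congr 1
      apply Complex.ext <;> simp
    rw [e, ← intervalIntegral.integral_const_mul, ← intervalIntegral.integral_sub
      hint'.intervalIntegrable (hcont.intervalIntegrable _ _)]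
    congr 1
    ext x
    rw [dslope_of_ne _ (sub_ne_zero.mp (hne x)), slope_def_field]
    ring
  simp_rw [key]
  refine Tendsto.sub ?_ (hL.const_mul _)
  exact intervalIntegral_tendsto_integral hint' 
    (tendsto_atBot_add_const_left _ _ tendsto_neg_atTop_atBot |>.congr
      fun R => (sub_eq_add_neg _ _).symm)
    (tendsto_atTop_add_const_left _ _ tendsto_id)

lemma tendsto_integral_vertical_dslope {h : ℂ → ℂ} {y₁ y₂ B : ℝ} {v : ℂ} (h12 : y₁ < y₂)
    (hB : ∀ z : ℂ, y₁ ≤ z.im → z.im ≤ y₂ → ‖h z‖ ≤ B) (hv : ‖h v‖ ≤ B)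
    {X : ℝ → ℝ} (hX : ∀ R, |X R - v.re| = |R|) :
    Tendsto (fun R : ℝ => ∫ t in y₁..y₂, dslope h v (X R + t * I)) atTop (𝓝 0) := by
  have hlim : Tendsto (fun R : ℝ => 2 * B * |y₂ - y₁| / R) atTop (𝓝 0) :=
    tendsto_const_nhds.div_atTop tendsto_id
  refine squeeze_zero_norm' ?_ hlim
  filter_upwards [eventually_gt_atTop 0] with R hR
  have : ∀ t ∈ uIoc y₁ y₂, ‖dslope h v (X R + t * I)‖ ≤ 2 * B / R := by
    intro t ht
    rw [uIoc_of_le h12.le] at ht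
    have h1 : R ≤ ‖(X R + t * I : ℂ) - v‖ := by
      have := Complex.abs_re_le_norm ((X R + t * I : ℂ) - v)
      simp only [sub_re, add_re, ofReal_re, mul_re, I_re, mul_zero, ofReal_im, I_im, mul_one,
        add_zero, sub_self] at this
      rwa [hX, abs_of_pos hR] at this
    have hne : (X R + t * I : ℂ) ≠ v := fun e => by
      rw [e, sub_self, norm_zero] at h1
      linarith
    rw [dslope_of_ne _ hne, slope_def_field, norm_div]
    have h2 : ‖h (X R + t * I) - h v‖ ≤ 2 * B := by
      refine (norm_sub_le _ _).trans ?_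
      have := hB (X R + t * I) (by simpa using ht.1.le) (by simpa using ht.2)
      linarith
    have := norm_nonneg (h v)
    gcongr
    linarith
  refine (intervalIntegral.norm_integral_le_of_norm_le_const this).trans (le_of_eq ?_)
  ring

/-- Cauchy's integral formula in a horizontal strip. -/
lemma lineCauchy_sub_lineCauchy {h : ℂ → ℂ} {b₁ b₂ y₁ y₂ B : ℝ} {v : ℂ}
    (hb₁ : b₁ < y₁) (hv₁ : y₁ < v.im) (hv₂ : v.im < y₂) (hb₂ : y₂ < b₂)
    (hh : DifferentiableOn ℂ h {z | b₁ < z.im ∧ z.im < b₂})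
    (hB : ∀ z : ℂ, y₁ ≤ z.im → z.im ≤ y₂ → ‖h z‖ ≤ B)
    (hi₁ : Integrable fun x : ℝ => h (x + y₁ * I)) (hi₂ : Integrable fun x : ℝ => h (x + y₂ * I)) :
    lineCauchy (fun x => h (x + y₁ * I)) y₁ v - lineCauchy (fun x => h (x + y₂ * I)) y₂ v
      = 2 * Real.pi * I * h v := by
  set O := {z : ℂ | b₁ < z.im ∧ z.im < b₂}
  have hO : IsOpen O := (isOpen_lt continuous_const continuous_im).inter
    (isOpen_lt continuous_im continuous_const)
  have hvO : O ∈ 𝓝 v := hO.mem_nhds ⟨hb₁.trans hv₁, hv₂.trans hb₂⟩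
  have hF : DifferentiableOn ℂ (dslope h v) O := (Complex.differentiableOn_dslope hvO).mpr hh
  have h12 : y₁ < y₂ := hv₁.trans hv₂
  have hvB := hB v hv₁.le hv₂.le
  have T1 := tendsto_integral_line_dslope hv₁.ne' hi₁
    (tendsto_integral_inv_line_neg (sub_neg.mpr hv₁))
  have T2 := tendsto_integral_line_dslope hv₂.ne hi₂
    (tendsto_integral_inv_line_pos (sub_pos.mpr hv₂))
  have T3 := tendsto_integral_vertical_dslope h12 hB hvB (X := fun R => v.re + R) (by simp)
  have T4 := tendsto_integral_vertical_dslope h12 hB hvB (X := fun R => v.re - R) (by simp)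
  have T := ((T1.sub T2).add (T3.const_smul I)).sub (T4.const_smul I)
  have Z : ∀ R : ℝ, (∫ x in (v.re - R)..(v.re + R), dslope h v (x + y₁ * I)) -
      (∫ x in (v.re - R)..(v.re + R), dslope h v (x + y₂ * I)) +
      I • (∫ t in y₁..y₂, dslope h v ((v.re + R : ℝ) + t * I)) -
      I • (∫ t in y₁..y₂, dslope h v ((v.re - R : ℝ) + t * I)) = 0 := by
    intro R
    have := integral_boundary_rect_eq_zero_of_differentiableOn (dslope h v)
      ⟨v.re - R, y₁⟩ ⟨v.re + R, y₂⟩ (hF.mono ?_)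
    · exact this
    · rintro z ⟨-, hz⟩
      simp only [mem_preimage, uIcc_of_le h12.le] at hz
      exact ⟨hb₁.trans_le hz.1, hz.2.trans_lt hb₂⟩
  simp_rw [Z] at T
  have := tendsto_nhds_unique T tendsto_const_nhds
  simp only [smul_zero, add_zero, sub_zero] at this
  linear_combination this

end StripCauchy

section HalfPlaneSplit
open MeasureTheory Filter

lemma isOpen_horizontalStrip (b₁ b₂ : ℝ) : IsOpen {z : ℂ | b₁ < z.im ∧ z.im < b₂} :=
  (isOpen_lt continuous_const continuous_im).inter (isOpen_lt continuous_im continuous_const)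

lemma integrable_line_of_decay {h : ℂ → ℂ} {b₁ b₂ y B : ℝ}
    (hh : DifferentiableOn ℂ h {z | b₁ < z.im ∧ z.im < b₂}) (h₁ : b₁ < y) (h₂ : y < b₂)
    (hB : ∀ x : ℝ, ‖h (x + y * I)‖ ≤ B * (1 + x ^ 2)⁻¹) :
    Integrable (fun x : ℝ => h (x + y * I)) ∧
      ∫ x : ℝ, ‖h (x + y * I)‖ ≤ B * Real.pi := by
  have hc : Continuous fun x : ℝ => h (x + y * I) :=
    hh.continuousOn.comp_continuous (by fun_prop) fun x => by simp [h₁, h₂]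
  have hb : Integrable fun x : ℝ => B * (1 + x ^ 2)⁻¹ := integrable_inv_one_add_sq.const_mul B
  have hi : Integrable fun x : ℝ => h (x + y * I) :=
    hb.mono' hc.aestronglyMeasurable (Eventually.of_forall hB)
  refine ⟨hi, (integral_mono hi.norm hb hB).trans_eq ?_⟩
  rw [integral_const_mul, integral_univ_inv_one_add_sq]

/-- A holomorphic function on the strip `-π < Im < 0`, decaying quadratically on a substrip,
is the sum of a bounded holomorphic function on `-π < Im` and of a function that is bounded and
Lipschitz away from the real line. -/
lemma exists_halfPlane_split {h : ℂ → ℂ} {a B : ℝ} (ha : 0 < a) (ha' : 3 * a < Real.pi)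
    (hB : 0 ≤ B) (hh : DifferentiableOn ℂ h {z | -Real.pi < z.im ∧ z.im < 0})
    (hb : ∀ z : ℂ, -Real.pi < z.im → z.im < 0 → ‖h z‖ ≤ B)
    (hd : ∀ z : ℂ, -(3 * a) ≤ z.im → z.im ≤ -a → ‖h z‖ ≤ B * (1 + z.re ^ 2)⁻¹) :
    ∃ g k : ℂ → ℂ, DifferentiableOn ℂ g {z | -Real.pi < z.im} ∧
      (∀ z : ℂ, -Real.pi < z.im → ‖g z‖ ≤ (1 + 1 / a) * B) ∧
      (∀ z : ℂ, -Real.pi < z.im → z.im ≤ -(2 * a) → g z = h z - k z) ∧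
      (∀ z : ℂ, z.im ≤ -(2 * a) → ‖k z‖ ≤ 1 / a * B) ∧
      (∀ z w : ℂ, z.im ≤ -(2 * a) → w.im ≤ -(2 * a) → ‖k z - k w‖ ≤ 1 / a ^ 2 * B * ‖z - w‖) := by
  obtain ⟨i₁, n₁⟩ := integrable_line_of_decay (y := -(3 * a)) (B := B) hh (by linarith)
    (by linarith) fun x => by
      simpa using hd (x + ((-(3 * a) : ℝ) : ℂ) * I) (by simp) (by simp; linarith)
  obtain ⟨i₂, n₂⟩ := integrable_line_of_decay (y := -a) (B := B) hh (by linarith)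
    (by linarith) fun x => by
      simpa using hd (x + ((-a : ℝ) : ℂ) * I) (by simp; linarith) (by simp)
  have hpi := Real.pi_pos
  set L₁ : ℂ → ℂ := lineCauchy (fun x : ℝ => h (x + ((-(3 * a) : ℝ) : ℂ) * I)) (-(3 * a))
  set L₂ : ℂ → ℂ := lineCauchy (fun x : ℝ => h (x + ((-a : ℝ) : ℂ) * I)) (-a)
  have hpiI : (2 * Real.pi * I : ℂ) ≠ 0 := two_pi_I_ne_zero
  have hn : ‖(2 * Real.pi * I : ℂ)⁻¹‖ = 1 / (2 * Real.pi) := by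
    simp [abs_of_pos hpi]
  have hsum : ∀ v : ℂ, -(3 * a) < v.im → v.im < -a → L₁ v - L₂ v = 2 * Real.pi * I * h v := by
    intro v h1 h2
    exact lineCauchy_sub_lineCauchy (b₁ := -Real.pi) (b₂ := 0) (B := B) (by linarith) h1 h2
      (by linarith) hh (fun z h3 h4 => hb z (by linarith) (by linarith)) i₁ i₂
  have hk : ∀ z : ℂ, z.im ≤ -(2 * a) → a ≤ |z.im - -a| := fun z hz => by
    rw [abs_of_nonpos (by linarith)]; linarith
  have hbound : ∀ {c : ℝ → ℂ} {y : ℝ} {v : ℂ}, Integrable c → ∫ x, ‖c x‖ ≤ B * Real.pi →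
      a ≤ |v.im - y| → ‖(2 * Real.pi * I : ℂ)⁻¹ * lineCauchy c y v‖ ≤ 1 / a * B := by
    intro c y v hc hcn hv
    rw [norm_mul, hn]
    calc 1 / (2 * Real.pi) * ‖lineCauchy c y v‖
        ≤ 1 / (2 * Real.pi) * (B * Real.pi / a) := by
          gcongr
          exact (norm_lineCauchy_le hc ha hv).trans (by gcongr)
      _ = 1 / a * B / 2 := by field_simp
      _ ≤ 1 / a * B := half_le_self (by positivity)
  set k : ℂ → ℂ := fun v => -((2 * Real.pi * I : ℂ)⁻¹ * L₂ v)
  have hkb : ∀ z : ℂ, z.im ≤ -(2 * a) → ‖k z‖ ≤ 1 / a * B := fun z hz => by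
    simp only [k, norm_neg]
    exact hbound i₂ n₂ (hk z hz)
  refine ⟨fun v => if -(2 * a) < v.im then (2 * Real.pi * I : ℂ)⁻¹ * L₁ v else h v - k v, k,
    ?_, ?_, ?_, hkb, ?_⟩
  · intro v hv
    refine DifferentiableAt.differentiableWithinAt ?_
    by_cases h3 : -(3 * a) < v.im
    · have hd1 : DifferentiableAt ℂ (fun v => (2 * Real.pi * I : ℂ)⁻¹ * L₁ v) v :=
        (differentiableAt_lineCauchy i₁ h3.ne').const_mul _
      refine hd1.congr_of_eventuallyEq ?_
      filter_upwards [(isOpen_lt continuous_const continuous_im).mem_nhds h3] with w hw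
      split_ifs with h4
      · rfl
      · have := hsum w hw (by linarith)
        simp only [k]
        field_simp
        linear_combination -this
    · have hd1 : DifferentiableAt ℂ h v :=
        hh.differentiableAt ((isOpen_horizontalStrip _ _).mem_nhds ⟨hv, by linarith⟩)
      have hd2 : DifferentiableAt ℂ k v :=
        ((differentiableAt_lineCauchy i₂ (by linarith)).const_mul _).neg
      refine (hd1.sub hd2).congr_of_eventuallyEq ?_
      have h4 : v.im < -(2 * a) := by linarith
      filter_upwards [(isOpen_lt continuous_im continuous_const).mem_nhds h4] with w hw
      rw [if_neg (not_lt.mpr (le_of_lt hw))]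
      rfl
  · intro v hv
    dsimp only
    split_ifs with h4
    · refine (hbound i₁ n₁ ?_).trans ?_
      · rw [abs_of_nonneg (by linarith)]; linarith
      · rw [add_mul]; linarith
    · have h5 := hkb v (not_lt.mp h4)
      have h6 := hb v hv (by linarith)
      refine (norm_sub_le _ _).trans ?_
      rw [add_mul]; linarith
  · intro v hv h4
    exact if_neg (not_lt.mpr h4)
  · intro z w hz hw
    have h1 := norm_lineCauchy_sub_le i₂ ha (hk z hz) (hk w hw)
    have h2 : k z - k w = -((2 * Real.pi * I : ℂ)⁻¹ * (L₂ z - L₂ w)) := by simp only [k]; ring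
    rw [h2, norm_neg, norm_mul, hn]
    calc 1 / (2 * Real.pi) * ‖L₂ z - L₂ w‖
        ≤ 1 / (2 * Real.pi) * (B * Real.pi / a ^ 2 * ‖z - w‖) := by
          gcongr
          exact h1.trans (by gcongr)
      _ = 1 / a ^ 2 * B * ‖z - w‖ / 2 := by field_simp
      _ ≤ 1 / a ^ 2 * B * ‖z - w‖ := half_le_self (by positivity)

end HalfPlaneSplit

section Planar
open Filter

/-- The corner `3/5 - 4/5 i` of the decomposition of the unit disc. -/
def cornerPt : ℂ := ⟨3 / 5, -(4 / 5)⟩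

lemma cornerPt_ne_zero_aux (w : ℂ) (hw : w.im < 0) : w + cornerPt ≠ 0 := fun h => by
  have := congrArg Complex.im h
  simp [cornerPt] at this
  linarith

/-- The Möbius map taking the unit disc to the lower half plane, and the point `cornerPt`
to infinity. -/
def diskToLower (z : ℂ) : ℂ := (1 - cornerPt * z) / (z - cornerPt)

/-- The inverse of `diskToLower`. -/
def lowerToDisk (w : ℂ) : ℂ := (1 + cornerPt * w) / (w + cornerPt)

/-- A polynomial vanishing at `cornerPt` and at its conjugate. -/
def cornerPoly (z : ℂ) : ℂ := z ^ 2 - 6 / 5 * z + 1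

lemma cornerPt_sq : cornerPt ^ 2 = 6 / 5 * cornerPt - 1 := by
  apply Complex.ext <;> simp [cornerPt, sq] <;> norm_num

lemma im_diskToLower (z : ℂ) :
    (diskToLower z).im = 4 / 5 * (normSq z - 1) / normSq (z - cornerPt) := by
  simp only [diskToLower, div_im, sub_re, sub_im, one_re, one_im, mul_re, mul_im, normSq_apply,
    cornerPt]
  ring

lemma re_diskToLower (z : ℂ) :
    (diskToLower z).re = (2 * z.re - 3 / 5 * (normSq z + 1)) / normSq (z - cornerPt) := by
  simp only [diskToLower, div_re, sub_re, sub_im, one_re, one_im, mul_re, mul_im, normSq_apply,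
    cornerPt]
  ring

lemma mem_unitDisk_iff {z : ℂ} : z ∈ unitDisk ↔ normSq z < 1 := by
  rw [mem_ball_zero_iff, normSq_eq_norm_sq, sq_lt_one_iff₀ (norm_nonneg _)]

lemma sub_cornerPt_ne_zero {z : ℂ} (hz : normSq z < 1 ∨ z.re ≤ 1 / 2 ∨ 3 / 4 ≤ z.re) :
    z - cornerPt ≠ 0 := fun h => by
  rw [sub_eq_zero] at h
  subst h
  rcases hz with h | h | h
  · simp [normSq_apply, cornerPt] at h
    norm_num at h
  · simp [cornerPt] at h
    norm_num at h
  · simp [cornerPt] at h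
    norm_num at h

lemma im_diskToLower_neg {z : ℂ} (hz : z ∈ unitDisk) : (diskToLower z).im < 0 := by
  rw [mem_unitDisk_iff] at hz
  rw [im_diskToLower]
  have := normSq_pos.mpr (sub_cornerPt_ne_zero (Or.inl hz))
  exact div_neg_of_neg_of_pos (by linarith) this

lemma re_ge_of_mem_Omega {z : ℂ} (hz : z ∈ Omega) (hz' : z ∉ unitDisk) : 3 / 4 ≤ z.re := by
  have h1 : 1 ≤ normSq z := by rw [mem_unitDisk_iff] at hz'; linarith
  have h2 : z ∈ ball ((3 : ℂ) / 2) 1 := hz.1.resolve_left hz'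
  have h3 : normSq (z - 3 / 2) < 1 := by
    rw [mem_ball_iff_norm] at h2
    rwa [normSq_eq_norm_sq, sq_lt_one_iff₀ (norm_nonneg _)]
  have e : (3 / 2 : ℂ) = ((3 / 2 : ℝ) : ℂ) := by norm_num
  rw [e] at h3
  simp only [normSq_apply, sub_re, sub_im, ofReal_re, ofReal_im] at h1 h3
  nlinarith

lemma diskToLower_mem_slitPlane {z : ℂ} (hz : z ∈ Omega) : diskToLower z ∈ slitPlane := by
  by_cases hz' : z ∈ unitDisk
  · exact Or.inr (im_diskToLower_neg hz').ne
  · refine Or.inl ?_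
    have h0 := re_ge_of_mem_Omega hz hz'
    have h2 : z ∈ ball ((3 : ℂ) / 2) 1 := hz.1.resolve_left hz'
    have h3 : normSq (z - 3 / 2) < 1 := by
      rw [mem_ball_iff_norm] at h2
      rwa [normSq_eq_norm_sq, sq_lt_one_iff₀ (norm_nonneg _)]
    have e : (3 / 2 : ℂ) = ((3 / 2 : ℝ) : ℂ) := by norm_num
    rw [e] at h3
    rw [re_diskToLower]
    refine div_pos ?_ (normSq_pos.mpr (sub_cornerPt_ne_zero (Or.inr (Or.inr h0))))
    simp only [normSq_apply, sub_re, sub_im, ofReal_re, ofReal_im] at h3 ⊢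
    nlinarith

lemma neg_diskToLower_mem_slitPlane {z : ℂ} (hz : ‖z‖ ≤ 1) (hz' : z.re ≤ 1 / 2) :
    -diskToLower z ∈ slitPlane := by
  have hpos := normSq_pos.mpr (sub_cornerPt_ne_zero (Or.inr (Or.inl hz')))
  rcases hz.lt_or_eq with h | h
  · exact Or.inr
      (by simpa using (im_diskToLower_neg (mem_ball_zero_iff.mpr h)).ne)
  · refine Or.inl ?_
    rw [neg_re, re_diskToLower, normSq_eq_norm_sq z, h, ← neg_div]
    exact div_pos (by linarith) hpos

lemma differentiableAt_diskToLower {z : ℂ} (hz : z - cornerPt ≠ 0) :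
    DifferentiableAt ℂ diskToLower z :=
  DifferentiableAt.div (by fun_prop) (by fun_prop) hz

lemma sub_cornerPt_ne_zero_of_mem_slitPlane {z : ℂ} (hz : diskToLower z ∈ slitPlane) :
    z - cornerPt ≠ 0 := fun h => by
  rw [diskToLower, h, div_zero] at hz
  exact slitPlane_ne_zero hz rfl

lemma lowerToDisk_diskToLower {z : ℂ} (hz : z - cornerPt ≠ 0) :
    lowerToDisk (diskToLower z) = z := by
  have h1 : diskToLower z + cornerPt = (1 - cornerPt ^ 2) / (z - cornerPt) := by
    rw [diskToLower]; field_simp; ring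
  have h2 : 1 + cornerPt * diskToLower z = z * (1 - cornerPt ^ 2) / (z - cornerPt) := by
    rw [diskToLower]; field_simp; ring
  have h3 : (1 - cornerPt ^ 2 : ℂ) ≠ 0 := fun h => by
    have := congrArg Complex.re h
    simp [cornerPt, sq] at this
    norm_num at this
  rw [lowerToDisk, h1, h2]
  field_simp

lemma lowerToDisk_mem {w : ℂ} (hw : w.im < 0) : lowerToDisk w ∈ unitDisk := by
  have hpos := normSq_pos.mpr (cornerPt_ne_zero_aux w hw)
  rw [mem_unitDisk_iff, lowerToDisk, normSq_div, div_lt_one hpos]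
  simp only [normSq_apply, cornerPt, add_re, add_im, one_re, one_im, mul_re, mul_im]
  nlinarith

lemma norm_cornerPoly_lowerToDisk {w : ℂ} (hw : w.im < 0) :
    ‖cornerPoly (lowerToDisk w)‖ = 64 / 25 * ‖w‖ / normSq (w + cornerPt) := by
  have h0 := cornerPt_ne_zero_aux w hw
  have h1 : cornerPoly (lowerToDisk w) = (64 / 25 : ℝ) * cornerPt * w / (w + cornerPt) ^ 2 := by
    rw [cornerPoly, lowerToDisk]
    field_simp
    push_cast
    linear_combination (5 - 6 * w + 5 * w ^ 2) * cornerPt_sq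
  have h2 : ‖cornerPt‖ = 1 := by
    rw [← sq_eq_sq₀ (norm_nonneg _) zero_le_one, ← normSq_eq_norm_sq]
    simp [normSq_apply, cornerPt]
    norm_num
  rw [h1, norm_div, norm_mul, norm_mul, h2, norm_pow, normSq_eq_norm_sq, norm_real]
  norm_num

lemma norm_cornerPoly_le {z : ℂ} (hz : ‖z‖ ≤ 1) : ‖cornerPoly z‖ ≤ 4 := by
  have h1 : ‖z ^ 2‖ ≤ 1 := by rw [norm_pow]; exact pow_le_one₀ (norm_nonneg _) hz
  have h2 : ‖(6 / 5 : ℂ) * z‖ ≤ 6 / 5 := by rw [norm_mul]; norm_num; linarith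
  have h3 := norm_add_le (z ^ 2 - 6 / 5 * z) 1
  have h4 := norm_sub_le (z ^ 2) (6 / 5 * z)
  rw [norm_one] at h3
  rw [cornerPoly]
  linarith

lemma cornerPoly_ne_zero {z : ℂ} (hz' : z.re ≤ 1 / 2) : cornerPoly z ≠ 0 := by
  intro h
  have e : cornerPoly z = (z - ⟨3 / 5, 4 / 5⟩) * (z - ⟨3 / 5, -(4 / 5)⟩) := by
    rw [cornerPoly]
    apply Complex.ext <;> simp [sq] <;> ring
  rw [e, mul_eq_zero, sub_eq_zero, sub_eq_zero] at h
  rcases h with h | h <;> subst h <;> norm_num at hz'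

lemma inv_cosh_decay (x : ℝ) : Real.exp x / (Real.exp x ^ 2 + 1) ≤ (1 + x ^ 2)⁻¹ := by
  have hx := Real.exp_pos x
  have key : 1 + x ^ 2 ≤ Real.exp x + Real.exp (-x) := by
    have : ∀ t : ℝ, 0 ≤ t → 1 + t ^ 2 ≤ Real.exp t + Real.exp (-t) := by
      intro t ht
      have h1 := Real.cosh_sq (t / 2)
      have h2 := Real.self_le_sinh_iff.mpr (show 0 ≤ t / 2 by positivity)
      have h3 := Real.cosh_eq t
      have h4 := Real.cosh_two_mul (t / 2)
      rw [show 2 * (t / 2) = t by ring] at h4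
      nlinarith
    rcases le_total 0 x with h | h
    · exact this x h
    · have := this (-x) (by linarith)
      rw [neg_neg, neg_sq] at this
      linarith
  rw [Real.exp_neg] at key
  rw [div_le_iff₀ (by positivity), inv_mul_eq_div, le_div_iff₀ (by positivity)]
  calc Real.exp x * (1 + x ^ 2) ≤ Real.exp x * (Real.exp x + (Real.exp x)⁻¹) := by gcongr
    _ = Real.exp x ^ 2 + 1 := by field_simp

lemma im_exp_neg {v : ℂ} (h1 : -Real.pi < v.im) (h2 : v.im < 0) : (Complex.exp v).im < 0 := by
  rw [exp_im]
  exact mul_neg_of_pos_of_neg (Real.exp_pos _) (Real.sin_neg_of_neg_of_neg_pi_lt h2 h1)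

lemma norm_cornerPoly_exp_le {a : ℝ} (ha : 0 < a) (ha' : a ≤ 1 / 2) {v : ℂ}
    (h1 : -(3 * a) ≤ v.im) (h2 : v.im ≤ -a) :
    ‖cornerPoly (lowerToDisk (Complex.exp v))‖ ≤ 4 / Real.sin a ^ 2 * (1 + v.re ^ 2)⁻¹ := by
  have hpi := Real.pi_gt_three
  have hs : 0 < Real.sin a := Real.sin_pos_of_pos_of_lt_pi ha (by linarith)
  have hs1 := Real.sin_le_one a
  have hsv : Real.sin a ≤ -Real.sin v.im := by
    rw [← Real.sin_neg]
    exact Real.sin_le_sin_of_le_of_le_pi_div_two (by linarith) (by linarith) (by linarith)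
  have hx := Real.exp_pos v.re
  rw [norm_cornerPoly_lowerToDisk (im_exp_neg (by linarith) (by linarith)), norm_exp]
  have hlow : 16 / 25 * Real.sin a ^ 2 * (Real.exp v.re ^ 2 + 1)
      ≤ normSq (Complex.exp v + cornerPt) := by
    have e : (Complex.exp v + cornerPt).im = -(Real.exp v.re * -Real.sin v.im + 4 / 5) := by
      simp [exp_im, cornerPt]
      ring
    have h3 : Real.exp v.re * Real.sin a + 4 / 5 ≤ Real.exp v.re * -Real.sin v.im + 4 / 5 := by
      gcongr
    have h4 : 0 < Real.exp v.re * Real.sin a := by positivity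
    rw [normSq_apply, e]
    have h5 : (Real.exp v.re * Real.sin a + 4 / 5) ^ 2
        ≤ (Real.exp v.re * -Real.sin v.im + 4 / 5) ^ 2 := by gcongr
    have h6 : Real.sin a ^ 2 ≤ 1 := pow_le_one₀ hs.le hs1
    nlinarith [mul_self_nonneg (Complex.exp v + cornerPt).re,
      sq_nonneg (Real.exp v.re * Real.sin a)]
  calc 64 / 25 * Real.exp v.re / normSq (Complex.exp v + cornerPt)
      ≤ 64 / 25 * Real.exp v.re / (16 / 25 * Real.sin a ^ 2 * (Real.exp v.re ^ 2 + 1)) := by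
        gcongr
    _ = 4 / Real.sin a ^ 2 * (Real.exp v.re / (Real.exp v.re ^ 2 + 1)) := by
        field_simp
        norm_num
    _ ≤ _ := by
        gcongr
        exact inv_cosh_decay _

lemma log_neg_sub_pi_mul_I {w : ℂ} (hw : w.im < 0) :
    Complex.log (-w) - Real.pi * I = Complex.log w := by
  rw [Complex.log, Complex.log, norm_neg, arg_neg_eq_arg_add_pi_of_im_neg hw]
  push_cast
  ring

lemma exists_planar_extension {z₀ : ℂ} (hz : ‖z₀‖ ≤ 1) (hz' : z₀.re ≤ 1 / 2) :
    ∃ C : ℝ, 0 ≤ C ∧ ∀ (f : ℂ → ℂ) (B : ℝ), 0 ≤ B → DifferentiableOn ℂ f unitDisk →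
      (∀ z ∈ unitDisk, ‖f z‖ ≤ B) → ∃ g : ℂ → ℂ, DifferentiableOn ℂ g Omega ∧
        (∀ z ∈ Omega, ‖g z‖ ≤ C * B) ∧
        ∀ z ∈ unitDisk, ‖g z - cornerPoly z * f z‖ ≤ C * B * ‖z - z₀‖ := by
  have hpi := Real.pi_gt_three
  set V : ℂ → ℂ := fun z => Complex.log (-diskToLower z) - Real.pi * I with hV
  have hslit := neg_diskToLower_mem_slitPlane hz hz'
  have hv0 : (V z₀).im < 0 := by
    have h1 := (arg_le_pi (-diskToLower z₀)).lt_of_ne (mem_slitPlane_iff_arg.mp hslit).1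
    simpa [hV, log_im] using h1
  obtain ⟨a, ha, ha1, ha2⟩ : ∃ a : ℝ, 0 < a ∧ a ≤ 1 / 2 ∧ (V z₀).im < -(2 * a) := by
    refine ⟨min (1 / 2) (-(V z₀).im / 3), lt_min (by norm_num) (by linarith), min_le_left _ _, ?_⟩
    have := min_le_right (1 / 2) (-(V z₀).im / 3)
    linarith
  have hVd : DifferentiableAt ℂ V z₀ :=
    ((differentiableAt_diskToLower
      (sub_cornerPt_ne_zero (Or.inr (Or.inl hz')))).neg.clog hslit).sub_const _
  obtain ⟨M, hM⟩ := hVd.isBigO_sub.bound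
  obtain ⟨δ, hδ, hδV⟩ := Metric.eventually_nhds_iff.mp
    (hM.and (hVd.continuousAt.eventually
      ((isOpen_lt continuous_im continuous_const).mem_nhds ha2)))
  have hM' : ∀ z, dist z z₀ < δ → ‖V z - V z₀‖ ≤ |M| * ‖z - z₀‖ := fun z hz =>
    (hδV hz).1.trans (mul_le_mul_of_nonneg_right (le_abs_self _) (norm_nonneg _))
  have hs : 0 < Real.sin a := Real.sin_pos_of_pos_of_lt_pi ha (by linarith)
  set s := 4 / Real.sin a ^ 2 with hsdef
  have hs4 : 4 ≤ s := by
    rw [hsdef, le_div_iff₀ (by positivity)]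
    have : Real.sin a ^ 2 ≤ 1 := pow_le_one₀ hs.le (Real.sin_le_one a)
    linarith
  set K := (1 + 2 / a) * s with hK
  have hK0 : 0 ≤ K := by positivity
  refine ⟨K + 1 / a ^ 2 * s * |M| + (K + 4) / δ, by positivity, fun f B hB hf hfB => ?_⟩
  have hZ : ∀ v : ℂ, -Real.pi < v.im → v.im < 0 → lowerToDisk (Complex.exp v) ∈ unitDisk :=
    fun v h1 h2 => lowerToDisk_mem (im_exp_neg h1 h2)
  obtain ⟨G, k, hG, hGB, hGk, hkB, hkL⟩ := exists_halfPlane_split (a := a) (B := s * B)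
    (h := fun v => cornerPoly (lowerToDisk (Complex.exp v)) * f (lowerToDisk (Complex.exp v)))
    ha (by linarith) (by positivity)
    (by
      have hL : DifferentiableOn ℂ (fun v => lowerToDisk (Complex.exp v))
          {z | -Real.pi < z.im ∧ z.im < 0} := by
        refine DifferentiableOn.div (by fun_prop) (by fun_prop) fun v hv => ?_
        exact cornerPt_ne_zero_aux _ (im_exp_neg hv.1 hv.2)
      refine DifferentiableOn.mul ?_ (hf.comp hL fun v hv => hZ v hv.1 hv.2)
      exact ((hL.pow 2).sub (hL.const_mul _)).add_const _)
    (by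
      intro v h1 h2
      rw [norm_mul]
      have h3 := norm_cornerPoly_le (mem_ball_zero_iff.mp (hZ v h1 h2)).le
      exact mul_le_mul (h3.trans hs4) (hfB _ (hZ v h1 h2)) (norm_nonneg _) (by positivity))
    (by
      intro v h1 h2
      rw [norm_mul, mul_right_comm]
      exact mul_le_mul (norm_cornerPoly_exp_le ha ha1 h1 h2)
        (hfB _ (hZ v (by linarith) (by linarith))) (norm_nonneg _) (by positivity))
  have hlog : ∀ z ∈ Omega, -Real.pi < (Complex.log (diskToLower z)).im := fun z _ => by
    rw [log_im]; exact neg_pi_lt_arg _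
  have hgB : ∀ z ∈ Omega, ‖G (Complex.log (diskToLower z)) + k (V z₀)‖ ≤ K * B := fun z hz => by
    refine (norm_add_le _ _).trans ((add_le_add (hGB _ (hlog z hz)) (hkB _ ha2.le)).trans ?_)
    rw [hK]
    apply le_of_eq
    ring
  refine ⟨fun z => G (Complex.log (diskToLower z)) + k (V z₀), ?_, ?_, ?_⟩
  · refine (hG.comp (fun z hz => ?_) fun z hz => hlog z hz).add_const _
    have h1 := diskToLower_mem_slitPlane hz
    exact ((differentiableAt_diskToLower
      (sub_cornerPt_ne_zero_of_mem_slitPlane h1)).clog h1).differentiableWithinAt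
  · intro z hz
    refine (hgB z hz).trans (mul_le_mul_of_nonneg_right ?_ hB)
    have : 0 ≤ 1 / a ^ 2 * s * |M| + (K + 4) / δ := by positivity
    linarith
  · intro z hz1
    have him := im_diskToLower_neg hz1
    have hVz : V z = Complex.log (diskToLower z) := log_neg_sub_pi_mul_I him
    have h0 : diskToLower z ≠ 0 := fun h => by simp [h] at him
    have hzO : z ∈ Omega := by
      refine ⟨Or.inl hz1, fun h => ?_⟩
      rw [h, mem_ball_zero_iff] at hz1
      norm_num at hz1
    have hexp : lowerToDisk (Complex.exp (V z)) = z := by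
      rw [hVz, Complex.exp_log h0, lowerToDisk_diskToLower
        (sub_cornerPt_ne_zero (Or.inl (mem_unitDisk_iff.mp hz1)))]
    change ‖G (Complex.log (diskToLower z)) + k (V z₀) - cornerPoly z * f z‖ ≤ _
    by_cases hd : dist z z₀ < δ
    · have h1 := hGk (V z) (hVz ▸ hlog z hzO) (hδV hd).2.le
      rw [hexp] at h1
      rw [← hVz, h1]
      have h2 := hkL (V z₀) (V z) ha2.le (hδV hd).2.le
      rw [norm_sub_rev (V z₀)] at h2
      calc _ = ‖k (V z₀) - k (V z)‖ := by congr 1; ring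
        _ ≤ 1 / a ^ 2 * (s * B) * (|M| * ‖z - z₀‖) := h2.trans (by gcongr; exact hM' z hd)
        _ = 1 / a ^ 2 * s * |M| * B * ‖z - z₀‖ := by ring
        _ ≤ _ := by
          gcongr
          have : 0 ≤ (K + 4) / δ := by positivity
          linarith
    · rw [dist_eq_norm, not_lt] at hd
      have h3 : ‖cornerPoly z * f z‖ ≤ 4 * B := by
        rw [norm_mul]
        exact mul_le_mul (norm_cornerPoly_le (mem_ball_zero_iff.mp hz1).le) (hfB z hz1)
          (norm_nonneg _) (by norm_num)
      calc _ ≤ K * B + 4 * B := (norm_sub_le _ _).trans (add_le_add (hgB z hzO) h3)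
        _ = (K + 4) / δ * B * δ := by field_simp
        _ ≤ _ := by
          gcongr
          have : 0 ≤ K + 1 / a ^ 2 * s * |M| := by positivity
          linarith

end Planar

section Weights

/-- Sheets over the unit disc of a map `r` of the unit disc onto `Omega`, numbered compatibly
with a branch `ℓ` of the logarithm of `3 / 2 - r`. -/
structure IsSheetModel (r ℓ : ℂ → ℂ) (q : ℤ → ℂ → ℂ) : Prop where
  differentiableOn_map : DifferentiableOn ℂ r unitDisk
  map_mem : ∀ x ∈ unitDisk, r x ∈ Omega
  differentiableOn_log : DifferentiableOn ℂ ℓ unitDisk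
  exp_log : ∀ x ∈ unitDisk, Complex.exp (ℓ x) = 3 / 2 - r x
  differentiableOn_sheet : ∀ n, DifferentiableOn ℂ (q n) unitDisk
  sheet_mem : ∀ n, ∀ z ∈ unitDisk, q n z ∈ unitDisk
  map_sheet : ∀ n, ∀ z ∈ unitDisk, r (q n z) = z
  log_sheet : ∀ n : ℤ, ∀ z ∈ unitDisk,
    ℓ (q n z) = Complex.log (3 / 2 - z) + 2 * Real.pi * n * I
  exists_sheet : ∀ x ∈ unitDisk, r x ∈ unitDisk → ∃ n, q n (r x) = x

/-- A difference quotient at a point is bounded if the function is bounded. -/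
lemma exists_norm_sub_le_mul {s : Set ℂ} {F : ℂ → ℂ} {z₀ : ℂ} (hF : DifferentiableAt ℂ F z₀)
    {K : ℝ} (hK : ∀ z ∈ s, ‖F z - F z₀‖ ≤ K) :
    ∃ C : ℝ, 0 ≤ C ∧ ∀ z ∈ s, ‖F z - F z₀‖ ≤ C * ‖z - z₀‖ := by
  obtain ⟨M, hM⟩ := hF.isBigO_sub.bound
  obtain ⟨δ, hδ, hδM⟩ := Metric.eventually_nhds_iff.mp hM
  refine ⟨|M| + |K| / δ, by positivity, fun z hz => ?_⟩
  by_cases hd : dist z z₀ < δ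
  · refine (hδM hd).trans (mul_le_mul_of_nonneg_right ?_ (norm_nonneg _))
    have : 0 ≤ |K| / δ := by positivity
    linarith [le_abs_self M]
  · rw [dist_eq_norm, not_lt] at hd
    calc _ ≤ |K| := (hK z hz).trans (le_abs_self K)
      _ = |K| / δ * δ := by field_simp
      _ ≤ _ := by
        gcongr
        linarith [abs_nonneg M]

/-- The entire function `(exp u - 1) / u`. -/
def expQuot (u : ℂ) : ℂ := dslope Complex.exp 0 u

lemma expQuot_zero : expQuot 0 = 1 := by simp [expQuot]

lemma differentiable_expQuot : Differentiable ℂ expQuot := by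
  rw [← differentiableOn_univ]
  exact (Complex.differentiableOn_dslope Filter.univ_mem).mpr differentiable_exp.differentiableOn

lemma expQuot_of_ne {u : ℂ} (hu : u ≠ 0) : expQuot u = (Complex.exp u - 1) / u := by
  rw [expQuot, dslope_of_ne _ hu, slope_def_field]
  simp

lemma norm_expQuot_sq_le {u : ℂ} (hu : ‖Complex.exp u‖ ≤ 5 / 2) :
    ‖expQuot u ^ 2‖ ≤ 25 * (1 + ‖u‖ ^ 2)⁻¹ := by
  rcases eq_or_ne u 0 with rfl | h0
  · simp [expQuot_zero]
  have hpos : 0 < ‖u‖ := norm_pos_iff.mpr h0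
  rw [expQuot_of_ne h0, norm_pow, norm_div, div_pow, ← div_eq_mul_inv,
    div_le_div_iff₀ (by positivity) (by positivity)]
  rcases le_total ‖u‖ 1 with h | h
  · have h1 : ‖Complex.exp u - 1‖ ^ 2 ≤ (2 * ‖u‖) ^ 2 := by
      gcongr
      exact norm_exp_sub_one_le h
    have h2 : ‖u‖ ^ 2 ≤ 1 := pow_le_one₀ hpos.le h
    nlinarith
  · have h1 : ‖Complex.exp u - 1‖ ^ 2 ≤ (7 / 2) ^ 2 := by
      gcongr
      refine (norm_sub_le _ _).trans ?_
      rw [norm_one]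
      linarith
    have h2 : 1 ≤ ‖u‖ ^ 2 := one_le_pow₀ h
    nlinarith

lemma summable_inv_one_add_sq : Summable fun k : ℤ => (1 + (k : ℝ) ^ 2)⁻¹ := by
  refine Summable.of_norm_bounded_eventually (Real.summable_one_div_int_pow.mpr one_lt_two) ?_
  have : {n : ℤ | ¬ ‖(1 + (n : ℝ) ^ 2)⁻¹‖ ≤ 1 / (n : ℝ) ^ 2} ⊆ {0} := by
    intro n hn
    by_contra h0
    have h1 : (0 : ℝ) < (n : ℝ) ^ 2 := by
      have : (n : ℝ) ≠ 0 := by exact_mod_cast h0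
      positivity
    apply hn
    rw [Real.norm_of_nonneg (by positivity), one_div]
    gcongr
    linarith
  exact (Set.finite_singleton _).subset this

lemma hasSum_inv_one_add_sq_sub (m : ℤ) :
    HasSum (fun n : ℤ => (1 + ((n : ℝ) - m) ^ 2)⁻¹) (∑' k : ℤ, (1 + (k : ℝ) ^ 2)⁻¹) := by
  have := (Equiv.subRight m).hasSum_iff.mpr summable_inv_one_add_sq.hasSum
  simpa [Function.comp_def] using this

lemma exists_int_sq_le (y : ℝ) : ∃ m : ℤ, ∀ n : ℤ,
    ((n : ℝ) - m) ^ 2 ≤ (y - 2 * Real.pi * n) ^ 2 := by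
  have hpi := Real.pi_gt_three
  refine ⟨round (y / (2 * Real.pi)), fun n => ?_⟩
  set m := round (y / (2 * Real.pi))
  have h1 : |y - 2 * Real.pi * m| ≤ Real.pi := by
    have h := abs_sub_round (y / (2 * Real.pi))
    have e : y - 2 * Real.pi * m = 2 * Real.pi * (y / (2 * Real.pi) - m) := by field_simp
    rw [e, abs_mul, abs_of_pos (by positivity : 0 < 2 * Real.pi)]
    nlinarith
  rcases eq_or_ne n m with rfl | hne
  · simpa using sq_nonneg _
  have h2 : (1 : ℝ) ≤ |(n : ℝ) - m| := by
    exact_mod_cast Int.one_le_abs (sub_ne_zero.mpr hne)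
  rw [sq_le_sq]
  have h3 : |2 * Real.pi * ((n : ℝ) - m)| ≤ |y - 2 * Real.pi * n| + |y - 2 * Real.pi * m| := by
    have := abs_sub (y - 2 * Real.pi * m) (y - 2 * Real.pi * n)
    rw [show y - 2 * Real.pi * m - (y - 2 * Real.pi * n) = 2 * Real.pi * ((n : ℝ) - m) by ring]
      at this
    linarith
  rw [abs_mul, abs_of_pos (by positivity : 0 < 2 * Real.pi)] at h3
  nlinarith

lemma inv_one_add_sq_le {s t : ℝ} (h : |s - t| ≤ 1) :
    (1 + s ^ 2)⁻¹ ≤ 3 * (1 + t ^ 2)⁻¹ := by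
  rw [← div_eq_mul_inv, le_div_iff₀ (by positivity), inv_mul_eq_div, div_le_iff₀ (by positivity)]
  have := abs_le.mp h
  nlinarith [sq_nonneg (2 * s - t)]

/-- Weights localised to one sheet. -/
def sheetWeight (ℓ : ℂ → ℂ) (z₀ : ℂ) (n : ℤ) (x : ℂ) : ℂ :=
  expQuot (ℓ x - (Complex.log (3 / 2 - z₀) + 2 * Real.pi * n * I)) ^ 2

lemma half_le_re_sub {z : ℂ} (hz : ‖z‖ ≤ 1) : 1 / 2 ≤ (3 / 2 - z).re := by
  have h := (re_le_norm z).trans hz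
  have e : (3 / 2 : ℂ) = ((3 / 2 : ℝ) : ℂ) := by norm_num
  rw [e, sub_re, ofReal_re]
  linarith

lemma sub_ne_zero_of_norm_le {z : ℂ} (hz : ‖z‖ ≤ 1) : (3 / 2 - z : ℂ) ≠ 0 := fun h => by
  have := half_le_re_sub hz
  rw [h, zero_re] at this
  linarith

lemma one_le_norm_sub {z : ℂ} (hz : z.re ≤ 1 / 2) : 1 ≤ ‖(3 / 2 - z : ℂ)‖ := by
  refine le_trans ?_ (re_le_norm _)
  have e : (3 / 2 : ℂ) = ((3 / 2 : ℝ) : ℂ) := by norm_num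
  rw [e, sub_re, ofReal_re]
  linarith

lemma norm_sub_le_of_mem_Omega {z : ℂ} (hz : z ∈ Omega) : ‖(3 / 2 - z : ℂ)‖ ≤ 5 / 2 := by
  rcases hz.1 with h | h
  · rw [mem_ball_zero_iff] at h
    have := norm_sub_le (3 / 2 : ℂ) z
    have e : ‖(3 / 2 : ℂ)‖ = 3 / 2 := by norm_num
    linarith
  · rw [mem_ball_iff_norm, norm_sub_rev] at h
    linarith

variable {r ℓ : ℂ → ℂ} {q : ℤ → ℂ → ℂ} {z₀ : ℂ}

lemma IsSheetModel.norm_sheetWeight_le (H : IsSheetModel r ℓ q) (hz : ‖z₀‖ ≤ 1)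
    (hz' : z₀.re ≤ 1 / 2) (n : ℤ) {x : ℂ} (hx : x ∈ unitDisk) :
    ‖sheetWeight ℓ z₀ n x‖ ≤
      25 * (1 + ((ℓ x).im - (Complex.log (3 / 2 - z₀)).im - 2 * Real.pi * n) ^ 2)⁻¹ := by
  have h0 := sub_ne_zero_of_norm_le hz
  have hexp : ‖Complex.exp (ℓ x - (Complex.log (3 / 2 - z₀) + 2 * Real.pi * n * I))‖ ≤ 5 / 2 := by
    have e : Complex.exp (2 * Real.pi * n * I) = 1 := by
      rw [show (2 * Real.pi * n * I : ℂ) = n * (2 * Real.pi * I) by ring]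
      exact exp_int_mul_two_pi_mul_I n
    rw [Complex.exp_sub, Complex.exp_add, e, mul_one, Complex.exp_log h0, H.exp_log x hx, norm_div]
    exact (div_le_self (norm_nonneg _) (one_le_norm_sub hz')).trans
      (norm_sub_le_of_mem_Omega (H.map_mem x hx))
  refine (norm_expQuot_sq_le hexp).trans ?_
  gcongr 25 * (1 + ?_)⁻¹
  rw [sq_le_sq, abs_norm]
  refine le_trans (le_of_eq ?_) (abs_im_le_norm _)
  congr 1
  simp
  ring

lemma IsSheetModel.exists_weight_bound (H : IsSheetModel r ℓ q) (hz : ‖z₀‖ ≤ 1)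
    (hz' : z₀.re ≤ 1 / 2) {x₀ : ℂ} (hx₀ : x₀ ∈ unitDisk) :
    ∃ m : ℤ, ∃ U : Set ℂ, IsOpen U ∧ x₀ ∈ U ∧ U ⊆ unitDisk ∧ ∀ x ∈ U, ∀ n : ℤ,
      ‖sheetWeight ℓ z₀ n x‖ ≤ 75 * (1 + ((n : ℝ) - m) ^ 2)⁻¹ := by
  obtain ⟨m, hm⟩ := exists_int_sq_le ((ℓ x₀).im - (Complex.log (3 / 2 - z₀)).im)
  refine ⟨m, unitDisk ∩ ℓ ⁻¹' {w | |w.im - (ℓ x₀).im| < 1},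
    H.differentiableOn_log.continuousOn.isOpen_inter_preimage isOpen_ball
      (isOpen_lt (by fun_prop) continuous_const), ⟨hx₀, by simp⟩, inter_subset_left,
    fun x hx n => (H.norm_sheetWeight_le hz hz' n hx.1).trans ?_⟩
  have h1 : (1 + ((ℓ x).im - (Complex.log (3 / 2 - z₀)).im - 2 * Real.pi * n) ^ 2)⁻¹ ≤
      3 * (1 + ((ℓ x₀).im - (Complex.log (3 / 2 - z₀)).im - 2 * Real.pi * n) ^ 2)⁻¹ :=
    inv_one_add_sq_le (by
      rw [sub_sub_sub_cancel_right, sub_sub_sub_cancel_right]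
      exact le_of_lt hx.2)
  have h2 : (1 + ((ℓ x₀).im - (Complex.log (3 / 2 - z₀)).im - 2 * Real.pi * n) ^ 2)⁻¹ ≤
      (1 + ((n : ℝ) - m) ^ 2)⁻¹ := by
    gcongr (1 + ?_)⁻¹
    exact hm n
  linarith

lemma IsSheetModel.differentiableOn_sheetWeight (H : IsSheetModel r ℓ q) (n : ℤ) :
    DifferentiableOn ℂ (sheetWeight ℓ z₀ n) unitDisk :=
  (differentiable_expQuot.comp_differentiableOn (H.differentiableOn_log.sub_const _)).pow 2

lemma IsSheetModel.exists_sheetWeight_sub_le (H : IsSheetModel r ℓ q) (hz : ‖z₀‖ ≤ 1)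
    (hz' : z₀.re ≤ 1 / 2) :
    ∃ C : ℝ, 0 ≤ C ∧ ∀ k n : ℤ, ∀ z ∈ unitDisk,
      ‖sheetWeight ℓ z₀ n (q k z) - if n = k then 1 else 0‖ ≤
        C * ‖z - z₀‖ * (1 + ((n : ℝ) - k) ^ 2)⁻¹ := by
  have hpi := Real.pi_gt_three
  have h0 := sub_ne_zero_of_norm_le hz
  set L : ℂ → ℂ := fun z => Complex.log (3 / 2 - z) - Complex.log (3 / 2 - z₀) with hL
  have hw : ∀ k n : ℤ, ∀ z ∈ unitDisk, sheetWeight ℓ z₀ n (q k z) =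
      expQuot (L z + 2 * Real.pi * (k - n) * I) ^ 2 := fun k n z hz1 => by
    rw [sheetWeight, H.log_sheet k z hz1, hL]
    congr 2
    ring
  obtain ⟨C, hC, hCz⟩ := exists_norm_sub_le_mul (s := unitDisk) (z₀ := z₀) (K := 26)
    (F := fun z => expQuot (L z) ^ 2)
    (((differentiable_expQuot _).comp z₀ (((differentiableAt_id.const_sub _).clog
      (Or.inl (by have := half_le_re_sub hz; simpa using by linarith))).sub_const _)).pow 2)
    (by
      intro z hz1
      have e1 : expQuot (L z) ^ 2 = sheetWeight ℓ z₀ 0 (q 0 z) := by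
        rw [hw 0 0 z hz1]; simp
      have e2 : L z₀ = 0 := sub_self _
      rw [e1, e2, expQuot_zero]
      refine (norm_sub_le _ _).trans ?_
      have h1 := H.norm_sheetWeight_le hz hz' 0 (H.sheet_mem 0 z hz1)
      have h2 : (1 + ((ℓ (q 0 z)).im - (Complex.log (3 / 2 - z₀)).im
          - 2 * Real.pi * (0 : ℤ)) ^ 2)⁻¹ ≤ 1 := by
        apply inv_le_one_of_one_le₀
        linarith [sq_nonneg ((ℓ (q 0 z)).im - (Complex.log (3 / 2 - z₀)).im
          - 2 * Real.pi * (0 : ℤ))]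
      simp only [one_pow, norm_one]
      linarith)
  refine ⟨C + 4, by linarith, fun k n z hz1 => ?_⟩
  have hzn : ‖z‖ < 1 := mem_ball_zero_iff.mp hz1
  rw [hw k n z hz1]
  split_ifs with hnk
  · subst hnk
    have h1 := hCz z hz1
    have e2 : L z₀ = 0 := sub_self _
    simp only [e2, expQuot_zero, one_pow] at h1
    simp only [sub_self, mul_zero, zero_mul, add_zero, ne_eq, OfNat.ofNat_ne_zero,
      not_false_eq_true, zero_pow, inv_one, mul_one]
    exact h1.trans (mul_le_mul_of_nonneg_right (by linarith) (norm_nonneg _))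
  · rw [sub_zero]
    have h2 : (1 : ℝ) ≤ |(n : ℝ) - k| := by
      exact_mod_cast Int.one_le_abs (sub_ne_zero.mpr hnk)
    set u := L z + 2 * Real.pi * (k - n) * I with hu
    have harg : ∀ w : ℂ, ‖w‖ ≤ 1 → |(Complex.log (3 / 2 - w)).im| ≤ Real.pi / 2 := fun w hw1 => by
      rw [log_im]
      refine (abs_arg_lt_pi_div_two_iff.mpr (Or.inl ?_)).le
      have := half_le_re_sub hw1
      linarith
    have him : |(n : ℝ) - k| ≤ ‖u‖ := by
      refine le_trans ?_ (abs_im_le_norm _)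
      have e : u.im = (Complex.log (3 / 2 - z)).im - (Complex.log (3 / 2 - z₀)).im
          - 2 * Real.pi * ((n : ℝ) - k) := by
        simp [hu, hL]
        ring
      have h3 := harg z hzn.le
      have h4 := harg z₀ hz
      rw [e]
      have h5 := abs_sub_abs_le_abs_sub (2 * Real.pi * ((n : ℝ) - k))
        ((Complex.log (3 / 2 - z)).im - (Complex.log (3 / 2 - z₀)).im)
      have h6 := abs_sub (Complex.log (3 / 2 - z)).im (Complex.log (3 / 2 - z₀)).im
      rw [abs_mul, abs_of_pos (by positivity : 0 < 2 * Real.pi),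
        abs_sub_comm (2 * Real.pi * ((n : ℝ) - k))] at h5
      nlinarith
    have hu0 : u ≠ 0 := norm_pos_iff.mp (by linarith)
    have hexp : ‖Complex.exp u - 1‖ ≤ ‖z - z₀‖ := by
      have e : Complex.exp (2 * Real.pi * (k - n) * I) = 1 := by
        rw [show (2 * Real.pi * (k - n) * I : ℂ) = ((k - n : ℤ) : ℂ) * (2 * Real.pi * I) by
          push_cast; ring]
        exact exp_int_mul_two_pi_mul_I _
      rw [hu, hL, Complex.exp_add, e, mul_one, Complex.exp_sub, Complex.exp_log h0,
        Complex.exp_log (sub_ne_zero_of_norm_le hzn.le),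
        show ((3 / 2 - z) / (3 / 2 - z₀) - 1 : ℂ) = -(z - z₀) / (3 / 2 - z₀) by
          rw [div_sub_one h0]; congr 1; ring, norm_div, norm_neg]
      exact div_le_self (norm_nonneg _) (one_le_norm_sub hz')
    have hzz : ‖z - z₀‖ ≤ 2 := (norm_sub_le _ _).trans (by linarith)
    have hd : (1 + ((n : ℝ) - k) ^ 2) ≤ 2 * ‖u‖ ^ 2 := by
      have h3 : ((n : ℝ) - k) ^ 2 ≤ ‖u‖ ^ 2 := by
        rw [← sq_abs ((n : ℝ) - k)]
        gcongr
      have h4 : 1 ≤ ‖u‖ ^ 2 := one_le_pow₀ (h2.trans him)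
      linarith
    rw [expQuot_of_ne hu0, norm_pow, norm_div, div_pow, ← div_eq_mul_inv,
      div_le_div_iff₀ (by positivity) (by positivity)]
    calc _ ≤ (2 * ‖z - z₀‖) * (2 * ‖u‖ ^ 2) := by
          gcongr
          calc _ ≤ ‖z - z₀‖ ^ 2 := by gcongr
            _ ≤ _ := by rw [sq]; gcongr
      _ = 4 * ‖z - z₀‖ * ‖u‖ ^ 2 := by ring
      _ ≤ _ := by gcongr; linarith

lemma IsSheetModel.exists_extension (H : IsSheetModel r ℓ q) (hz : ‖z₀‖ ≤ 1)
    (hz' : z₀.re ≤ 1 / 2) :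
    ∃ C : ℝ, 0 ≤ C ∧ ∀ (f : ℤ → ℂ → ℂ) (B : ℝ), 0 ≤ B →
      (∀ n, DifferentiableOn ℂ (f n) unitDisk) → (∀ n, ∀ z ∈ unitDisk, ‖f n z‖ ≤ B) →
      ∃ G : ℂ → ℂ, DifferentiableOn ℂ G unitDisk ∧ (∀ x ∈ unitDisk, ‖G x‖ ≤ C * B) ∧
        ∀ n, ∀ z ∈ unitDisk, ‖G (q n z) - cornerPoly z * f n z‖ ≤ C * B * ‖z - z₀‖ := by
  obtain ⟨C₁, hC₁, hplanar⟩ := exists_planar_extension hz hz'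
  obtain ⟨C₂, hC₂, hweight⟩ := H.exists_sheetWeight_sub_le hz hz'
  set T := ∑' k : ℤ, (1 + (k : ℝ) ^ 2)⁻¹ with hT
  have hT0 : 0 ≤ T := tsum_nonneg fun k => by positivity
  refine ⟨75 * T * C₁ + (C₂ * T * C₁ + C₁), by positivity, fun f B hB hf hfB => ?_⟩
  choose g hg hgB hgf using fun n => hplanar (f n) B hB (hf n) (hfB n)
  have hbound : ∀ x₀ ∈ unitDisk, ∃ m : ℤ, ∃ U : Set ℂ, IsOpen U ∧ x₀ ∈ U ∧ U ⊆ unitDisk ∧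
      ∀ n : ℤ, ∀ x ∈ U, ‖sheetWeight ℓ z₀ n x * g n (r x)‖ ≤
        75 * C₁ * B * (1 + ((n : ℝ) - m) ^ 2)⁻¹ := by
    intro x₀ hx₀
    obtain ⟨m, U, hU, hxU, hUD, h⟩ := H.exists_weight_bound hz hz' hx₀
    refine ⟨m, U, hU, hxU, hUD, fun n x hx => ?_⟩
    rw [norm_mul]
    calc _ ≤ (75 * (1 + ((n : ℝ) - m) ^ 2)⁻¹) * (C₁ * B) :=
          mul_le_mul (h x hx n) (hgB n _ (H.map_mem x (hUD hx))) (norm_nonneg _) (by positivity)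
      _ = _ := by ring
  refine ⟨fun x => ∑' n : ℤ, sheetWeight ℓ z₀ n x * g n (r x), fun x₀ hx₀ => ?_,
    fun x hx => ?_, fun k z hz1 => ?_⟩
  · obtain ⟨m, U, hU, hxU, hUD, h⟩ := hbound x₀ hx₀
    refine DifferentiableAt.differentiableWithinAt
      (DifferentiableOn.differentiableAt (s := U) ?_ (hU.mem_nhds hxU))
    refine differentiableOn_tsum_of_summable_norm
      ((hasSum_inv_one_add_sq_sub m).summable.mul_left _) (fun n => ?_) hU h
    exact ((H.differentiableOn_sheetWeight n).mul
      ((hg n).comp H.differentiableOn_map H.map_mem)).mono hUD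
  · obtain ⟨m, U, hU, hxU, hUD, h⟩ := hbound x hx
    refine (tsum_of_norm_bounded ((hasSum_inv_one_add_sq_sub m).mul_left _)
      (fun n => h n x hxU)).trans ?_
    have : 0 ≤ (C₂ * T * C₁ + C₁) * B := by positivity
    rw [← hT]
    linarith
  · have hqz := H.sheet_mem k z hz1
    obtain ⟨m, U, hU, hxU, hUD, h⟩ := hbound _ hqz
    have hsum : Summable fun n : ℤ => sheetWeight ℓ z₀ n (q k z) * g n (r (q k z)) :=
      Summable.of_norm_bounded ((hasSum_inv_one_add_sq_sub m).summable.mul_left _)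
        fun n => h n _ hxU
    have hzO : z ∈ Omega := H.map_sheet k z hz1 ▸ H.map_mem _ hqz
    have h1 : HasSum (fun n : ℤ => (if n = k then (1 : ℂ) else 0) * g n z) (g k z) := by
      convert hasSum_ite_eq k (g k z) using 2 with n
      split_ifs with hn
      · rw [hn, one_mul]
      · rw [zero_mul]
    simp only [H.map_sheet k z hz1] at hsum ⊢
    have h2 := (hsum.hasSum.sub h1).norm_le_of_bounded
      (((hasSum_inv_one_add_sq_sub k).mul_left (C₂ * ‖z - z₀‖)).mul_right (C₁ * B)) (fun n => by
        rw [← sub_mul, norm_mul]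
        exact mul_le_mul (hweight k n z hz1) (hgB n z hzO) (norm_nonneg _) (by positivity))
    have h3 := hgf k z hz1
    have h4 : 0 ≤ 75 * T * C₁ * B * ‖z - z₀‖ := by positivity
    rw [← sub_add_sub_cancel _ (g k z)]
    refine (norm_add_le _ _).trans ((add_le_add h2 h3).trans ?_)
    rw [← hT]
    linarith

end Weights

section Algebra
open Filter

/-- Extension of a character along a homomorphism `φ` which is surjective up to the factor `m`
and modulo the ideal generated by `p`. -/
lemma exists_character_extension {R S : Type*} [CommRing R] [Algebra ℂ R] [CommRing S]
    [Algebra ℂ S] (φ : R →ₐ[ℂ] S) (ζ : R →ₐ[ℂ] ℂ) (m : R) (p : S) (hm : ζ m ≠ 0)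
    (hrel : ∀ f : S, ∃ G κ, φ G = φ m * f + p * κ)
    (hker : ∀ G κ, φ G = p * κ → ζ G = 0) :
    ∃ η : S →ₐ[ℂ] ℂ, ∀ g, η (φ g) = ζ g := by
  choose G κ hG using hrel
  have key : ∀ f G' κ', φ G' = φ m * f + p * κ' → ζ (G f) = ζ G' := fun f G' κ' h => by
    rw [← sub_eq_zero, ← map_sub]
    refine hker _ (κ f - κ') ?_
    rw [map_sub, hG, h]
    ring
  have key' : ∀ g, ζ (G (φ g)) = ζ m * ζ g := fun g => by
    rw [key (φ g) (m * g) 0 (by rw [map_mul]; ring), map_mul]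
  refine ⟨AlgHom.ofLinearMap
    { toFun := fun f => ζ (G f) / ζ m
      map_add' := fun f f' => by
        rw [key (f + f') (G f + G f') (κ f + κ f') (by rw [map_add, hG, hG]; ring), map_add,
          add_div]
      map_smul' := fun c f => by
        rw [key (c • f) (c • G f) (c • κ f) (by
          rw [map_smul, hG, smul_add, mul_smul_comm, mul_smul_comm]), map_smul, smul_eq_mul,
          RingHom.id_apply, smul_eq_mul, mul_div_assoc] } ?_ ?_, fun g => ?_⟩
  · change ζ (G 1) / ζ m = 1
    have := key' 1
    rw [map_one, map_one, mul_one] at this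
    rw [this, div_self hm]
  · intro f f'
    change ζ (G (f * f')) / ζ m = ζ (G f) / ζ m * (ζ (G f') / ζ m)
    have h : ζ (G f * G f' - m * G (f * f')) = 0 := by
      refine hker _ (φ m * f * κ f' + φ m * f' * κ f + p * κ f * κ f' - φ m * κ (f * f')) ?_
      rw [map_sub, map_mul, map_mul, hG, hG, hG]
      ring
    rw [map_sub, map_mul, map_mul, sub_eq_zero] at h
    field_simp
    rw [h, mul_comm]
  · change ζ (G (φ g)) / ζ m = ζ g
    rw [key', mul_div_cancel_left₀ _ hm]

/-- The map between maximal ideal spaces induced by a homomorphism. -/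
def charComap {R S : Type*} [NormedCommRing R] [NormedAlgebra ℂ R] [CompleteSpace R]
    [NormedCommRing S] [NormedAlgebra ℂ S] [CompleteSpace S] (φ : R →ₐ[ℂ] S)
    (η : characterSpace ℂ S) : characterSpace ℂ R :=
  CharacterSpace.equivAlgHom.symm ((CharacterSpace.equivAlgHom η).comp φ)

section
variable {R S : Type*} [NormedCommRing R] [NormedAlgebra ℂ R] [CompleteSpace R]
    [NormedCommRing S] [NormedAlgebra ℂ S] [CompleteSpace S]

@[simp] lemma charComap_apply (φ : R →ₐ[ℂ] S) (η : characterSpace ℂ S) (f : R) :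
    charComap φ η f = η (φ f) := rfl

lemma continuous_charComap (φ : R →ₐ[ℂ] S) : Continuous (charComap φ) :=
  Continuous.subtype_mk (WeakDual.continuous_of_continuous_eval fun f =>
    (WeakDual.eval_continuous (φ f)).comp continuous_subtype_val) _

end

lemma isClosed_holomorphic {D : Set ℂ} (hD : IsOpen D) :
    IsClosed {f : D →ᵇ ℂ | ∃ g : ℂ → ℂ, DifferentiableOn ℂ g D ∧ ∀ z : D, f z = g z} := by
  classical
  refine IsSeqClosed.isClosed fun u f hu huf => ?_
  choose g hg hug using hu
  refine ⟨fun z => if h : z ∈ D then f ⟨z, h⟩ else 0, ?_, fun z => by simp⟩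
  have h1 := BoundedContinuousFunction.tendsto_iff_tendstoUniformly.mp huf
  have h2 : TendstoUniformlyOn g (fun z => if h : z ∈ D then f ⟨z, h⟩ else 0) atTop D := by
    rw [Metric.tendstoUniformlyOn_iff]
    intro ε hε
    filter_upwards [Metric.tendstoUniformly_iff.mp h1 ε hε] with n hn z hz
    rw [dif_pos hz, ← hug n ⟨z, hz⟩]
    exact hn ⟨z, hz⟩
  exact h2.tendstoLocallyUniformlyOn.differentiableOn (Eventually.of_forall hg) hD

instance completeSpace_Hinf_unitDisk : CompleteSpace (Hinf unitDisk) :=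
  IsClosed.completeSpace_coe (hs := isClosed_holomorphic isOpen_ball)

instance completeSpace_HinfDiskInt : CompleteSpace HinfDiskInt := by
  refine IsClosed.completeSpace_coe (hs := ?_)
  have : (HinfDiskInt : Set (DiskInt →ᵇ ℂ)) = ⋂ n : ℤ,
      (fun f : DiskInt →ᵇ ℂ => f.compContinuous ⟨fun z : unitDisk => (z, n), by fun_prop⟩) ⁻¹'
        {f : unitDisk →ᵇ ℂ | ∃ g : ℂ → ℂ, DifferentiableOn ℂ g unitDisk ∧ ∀ z, f z = g z} := by
    ext f
    simp only [mem_iInter]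
    rfl
  rw [this]
  exact isClosed_iInter fun n =>
    (isClosed_holomorphic isOpen_ball).preimage (continuous_compContinuous _)

lemma exists_Hinf {g : ℂ → ℂ} (hg : DifferentiableOn ℂ g unitDisk) {C : ℝ}
    (hC : ∀ z ∈ unitDisk, ‖g z‖ ≤ C) :
    ∃ G : Hinf unitDisk, ∀ z : unitDisk, (G : unitDisk →ᵇ ℂ) z = g z :=
  ⟨⟨BoundedContinuousFunction.ofNormedAddCommGroup (fun z : unitDisk => g z)
    (continuousOn_iff_continuous_domRestrict.mp hg.continuousOn) C fun z => hC z z.2, g, hg,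
      fun _ => rfl⟩, fun _ => rfl⟩

lemma exists_HinfDiskInt {g : ℤ → ℂ → ℂ} (hg : ∀ n, DifferentiableOn ℂ (g n) unitDisk) {C : ℝ}
    (hC : ∀ n, ∀ z ∈ unitDisk, ‖g n z‖ ≤ C) :
    ∃ G : HinfDiskInt, ∀ (z : unitDisk) (n : ℤ), (G : DiskInt →ᵇ ℂ) (z, n) = g n z :=
  ⟨⟨BoundedContinuousFunction.ofNormedAddCommGroup (fun x : DiskInt => g x.2 x.1)
    (continuous_prod_of_discrete_right.mpr fun n =>
      continuousOn_iff_continuous_domRestrict.mp (hg n).continuousOn) C fun x => hC x.2 x.1 x.1.2,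
      fun n => ⟨g n, hg n, fun _ => rfl⟩⟩, fun _ _ => rfl⟩

lemma exists_eq_sub_mul {F : ℂ → ℂ} (hF : DifferentiableOn ℂ F unitDisk) {z₀ : ℂ} {C : ℝ}
    (hC : 0 ≤ C) (hFC : ∀ z ∈ unitDisk, ‖F z‖ ≤ C * ‖z - z₀‖) :
    ∃ κ : ℂ → ℂ, DifferentiableOn ℂ κ unitDisk ∧ (∀ z ∈ unitDisk, ‖κ z‖ ≤ C) ∧
      ∀ z ∈ unitDisk, F z = (z - z₀) * κ z := by
  by_cases h0 : z₀ ∈ unitDisk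
  · have hnhds : unitDisk ∈ 𝓝 z₀ := isOpen_ball.mem_nhds h0
    have hF0 : F z₀ = 0 := by
      have := hFC z₀ h0
      rwa [sub_self, norm_zero, mul_zero, norm_le_zero_iff] at this
    refine ⟨dslope F z₀, (Complex.differentiableOn_dslope hnhds).mpr hF, fun z hz => ?_,
      fun z _ => ?_⟩
    · rcases eq_or_ne z z₀ with rfl | hne
      · rw [dslope_same]
        refine norm_deriv_le_of_lip' hC ?_
        filter_upwards [hnhds] with w hw
        rw [hF0, sub_zero]
        exact hFC w hw
      · rw [dslope_of_ne _ hne, slope_def_field, hF0, sub_zero, norm_div,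
          div_le_iff₀ (norm_pos_iff.mpr (sub_ne_zero.mpr hne))]
        exact hFC z hz
    · have := sub_smul_dslope F z₀ z
      rw [smul_eq_mul, hF0, sub_zero] at this
      exact this.symm
  · have hne : ∀ z ∈ unitDisk, z - z₀ ≠ 0 := fun z hz h => h0 (sub_eq_zero.mp h ▸ hz)
    refine ⟨fun z => F z / (z - z₀), hF.div (by fun_prop) hne, fun z hz => ?_, fun z hz => ?_⟩
    · rw [norm_div, div_le_iff₀ (norm_pos_iff.mpr (hne z hz))]
      exact hFC z hz
    · rw [mul_div_cancel₀ _ (hne z hz)]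

lemma norm_le_of_mem_HinfDiskInt (f : HinfDiskInt) (z : unitDisk) (n : ℤ) :
    ‖(f : DiskInt →ᵇ ℂ) (z, n)‖ ≤ ‖f‖ := (f : DiskInt →ᵇ ℂ).norm_coe_le_norm _

end Algebra

section SheetAlgebra
open Filter

variable {r ℓ : ℂ → ℂ} {q : ℤ → ℂ → ℂ} {z₀ : ℂ}

lemma IsSheetModel.continuous_sheet (H : IsSheetModel r ℓ q) :
    Continuous fun x : DiskInt => (⟨q x.2 x.1, H.sheet_mem x.2 x.1 x.1.2⟩ : unitDisk) :=
  continuous_prod_of_discrete_right.mpr fun n => Continuous.subtype_mk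
    (continuousOn_iff_continuous_domRestrict.mp (H.differentiableOn_sheet n).continuousOn) _

/-- Restriction of a function on the unit disc to the sheets. -/
def IsSheetModel.pullback (H : IsSheetModel r ℓ q) : Hinf unitDisk →ₐ[ℂ] HinfDiskInt where
  toFun F := ⟨(F : unitDisk →ᵇ ℂ).compContinuous ⟨_, H.continuous_sheet⟩, fun n => by
    obtain ⟨g, hg, hFg⟩ := F.2
    exact ⟨fun z => g (q n z), hg.comp (H.differentiableOn_sheet n) (H.sheet_mem n),
      fun z => hFg _⟩⟩
  map_one' := rfl
  map_mul' _ _ := rfl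
  map_zero' := rfl
  map_add' _ _ := rfl
  commutes' _ := rfl

lemma IsSheetModel.pullback_apply (H : IsSheetModel r ℓ q) (F : Hinf unitDisk) (z : unitDisk)
    (n : ℤ) : (H.pullback F : DiskInt →ᵇ ℂ) (z, n) =
      (F : unitDisk →ᵇ ℂ) ⟨q n z, H.sheet_mem n z z.2⟩ := rfl

lemma Hinf_ext {F G : Hinf unitDisk}
    (h : ∀ z : unitDisk, (F : unitDisk →ᵇ ℂ) z = (G : unitDisk →ᵇ ℂ) z) : F = G :=
  Subtype.ext (BoundedContinuousFunction.ext h)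

lemma HinfDiskInt_ext {F G : HinfDiskInt}
    (h : ∀ (z : unitDisk) (n : ℤ), (F : DiskInt →ᵇ ℂ) (z, n) = (G : DiskInt →ᵇ ℂ) (z, n)) :
    F = G :=
  Subtype.ext (BoundedContinuousFunction.ext fun x => h x.1 x.2)

/-- `cornerPoly` evaluated in an algebra. -/
def cornerElem {R : Type*} [CommRing R] [Algebra ℂ R] (x : R) : R := x ^ 2 - (6 / 5 : ℂ) • x + 1

lemma map_cornerElem {R S : Type*} [CommRing R] [Algebra ℂ R] [CommRing S] [Algebra ℂ S]
    (φ : R →ₐ[ℂ] S) (x : R) : φ (cornerElem x) = cornerElem (φ x) := by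
  simp [cornerElem]

lemma cornerElem_complex (z : ℂ) : cornerElem z = cornerPoly z := rfl

variable {ruElem : Hinf unitDisk} {pElem : HinfDiskInt}

lemma IsSheetModel.pullback_map (H : IsSheetModel r ℓ q)
    (hr : ∀ z : unitDisk, (ruElem : unitDisk →ᵇ ℂ) z = r z)
    (hp : ∀ x : DiskInt, (pElem : DiskInt →ᵇ ℂ) x = (x.1 : ℂ)) : H.pullback ruElem = pElem :=
  HinfDiskInt_ext fun z n => by
    rw [H.pullback_apply, hr, hp]
    exact H.map_sheet n z z.2

lemma IsSheetModel.exists_pullback_eq (H : IsSheetModel r ℓ q)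
    (hr : ∀ z : unitDisk, (ruElem : unitDisk →ᵇ ℂ) z = r z)
    (hp : ∀ x : DiskInt, (pElem : DiskInt →ᵇ ℂ) x = (x.1 : ℂ))
    (hz : ‖z₀‖ ≤ 1) (hz' : z₀.re ≤ 1 / 2) (f : HinfDiskInt) :
    ∃ (G : Hinf unitDisk) (κ : HinfDiskInt), H.pullback G =
      H.pullback (cornerElem ruElem) * f + (pElem - algebraMap ℂ _ z₀) * κ := by
  obtain ⟨C, hC, hext⟩ := H.exists_extension hz hz'
  choose g hg hfg using f.2
  obtain ⟨G, hG, hGB, hGg⟩ := hext g ‖f‖ (norm_nonneg _) hg (fun n z hz => by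
    rw [← hfg n ⟨z, hz⟩]
    exact norm_le_of_mem_HinfDiskInt f _ _)
  have hpoly : Differentiable ℂ cornerPoly :=
    ((differentiable_id.pow 2).sub (differentiable_id.const_mul _)).add_const _
  choose κ hκ hκB hκF using fun n => exists_eq_sub_mul
    ((hG.comp (H.differentiableOn_sheet n) (H.sheet_mem n)).sub
      (hpoly.differentiableOn.mul (hg n))) (z₀ := z₀) (C := C * ‖f‖) (by positivity) (hGg n)
  obtain ⟨G', hG'⟩ := exists_Hinf hG hGB
  obtain ⟨κ', hκ'⟩ := exists_HinfDiskInt hκ hκB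
  refine ⟨G', κ', HinfDiskInt_ext fun z n => ?_⟩
  rw [map_cornerElem, H.pullback_map hr hp, H.pullback_apply, hG']
  have h1 : ((cornerElem pElem * f + (pElem - algebraMap ℂ _ z₀) * κ' : HinfDiskInt) :
      DiskInt →ᵇ ℂ) (z, n) = cornerPoly ((pElem : DiskInt →ᵇ ℂ) (z, n)) *
        (f : DiskInt →ᵇ ℂ) (z, n) + ((pElem : DiskInt →ᵇ ℂ) (z, n) - z₀) *
        (κ' : DiskInt →ᵇ ℂ) (z, n) := by
    simp [cornerElem, cornerPoly]
  rw [h1, hp, hκ', hfg n z, ← hκF n z z.2]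
  simp

lemma quarter_le_norm_sub {z w : ℂ} (hz : z.re ≤ 1 / 2) (hw : 3 / 4 ≤ w.re) :
    1 / 4 ≤ ‖w - z‖ := by
  refine le_trans ?_ (re_le_norm _)
  rw [sub_re]
  linarith

lemma IsSheetModel.exists_eq_mul (H : IsSheetModel r ℓ q)
    (hr : ∀ z : unitDisk, (ruElem : unitDisk →ᵇ ℂ) z = r z)
    (hp : ∀ x : DiskInt, (pElem : DiskInt →ᵇ ℂ) x = (x.1 : ℂ))
    (hz' : z₀.re ≤ 1 / 2) {G : Hinf unitDisk} {κ : HinfDiskInt}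
    (h : H.pullback G = (pElem - algebraMap ℂ _ z₀) * κ) :
    ∃ K : Hinf unitDisk, G = (ruElem - algebraMap ℂ _ z₀) * K := by
  classical
  obtain ⟨g, hg, hGg⟩ := G.2
  choose k hk hκk using κ.2
  have hgk : ∀ n, ∀ z ∈ unitDisk, g (q n z) = (z - z₀) * k n z := fun n z hz => by
    have h1 := congrArg (fun F : HinfDiskInt => (F : DiskInt →ᵇ ℂ) (⟨z, hz⟩, n)) h
    simp only [H.pullback_apply, hGg] at h1
    rw [h1, ← hκk n ⟨z, hz⟩]
    simp [hp]
  choose! N hN using H.exists_sheet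
  set K : ℂ → ℂ := fun x => if r x ∈ unitDisk then k (N x) (r x) else g x / (r x - z₀) with hK
  have hmul : ∀ x ∈ unitDisk, g x = (r x - z₀) * K x := fun x hx => by
    by_cases hrx : r x ∈ unitDisk
    · simp only [hK, if_pos hrx]
      rw [← hgk _ _ hrx, hN x hx hrx]
    · simp only [hK, if_neg hrx]
      rw [mul_div_cancel₀]
      have := quarter_le_norm_sub hz' (re_ge_of_mem_Omega (H.map_mem x hx) hrx)
      exact norm_pos_iff.mp (by linarith)
  have hdiff : DifferentiableOn ℂ K unitDisk := fun x hx => by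
    have hD := isOpen_ball.mem_nhds hx
    have hrc := H.differentiableOn_map.continuousOn.continuousAt hD
    refine DifferentiableAt.differentiableWithinAt ?_
    by_cases hrx : r x ∈ unitDisk
    · have hlogd : ∀ y, r y ∈ unitDisk → 3 / 2 - r y ∈ slitPlane := fun y hy => Or.inl (by
        have := half_le_re_sub (mem_ball_zero_iff.mp hy).le
        linarith)
      have hindex : ∀ y ∈ unitDisk, r y ∈ unitDisk →
          ℓ y - Complex.log (3 / 2 - r y) = 2 * Real.pi * N y * I := fun y hy hry => by
        have h2 := H.log_sheet (N y) (r y) hry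
        rw [hN y hy hry] at h2
        rw [h2, add_sub_cancel_left]
      have hc : ContinuousAt (fun y => ℓ y - Complex.log (3 / 2 - r y)) x :=
        (H.differentiableOn_log.continuousOn.continuousAt hD).sub
          ((continuousAt_const.sub hrc).clog (hlogd x hrx))
      have hev : K =ᶠ[𝓝 x] fun y => k (N x) (r y) := by
        filter_upwards [hD, hrc.preimage_mem_nhds (isOpen_ball.mem_nhds hrx),
          hc.preimage_mem_nhds (ball_mem_nhds _ one_pos)] with y hy hry hy1
        change r y ∈ unitDisk at hry
        simp only [hK, if_pos hry]
        have hNN : N y = N x := by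
          by_contra hne
          rw [mem_preimage, mem_ball_iff_norm, hindex y hy hry, hindex x hx hrx] at hy1
          have h1 : (1 : ℝ) ≤ |((N y - N x : ℤ) : ℝ)| := by
            exact_mod_cast Int.one_le_abs (sub_ne_zero.mpr hne)
          rw [show (2 * Real.pi * N y * I - 2 * Real.pi * N x * I : ℂ) =
            ((2 * Real.pi * (N y - N x : ℤ) : ℝ) : ℂ) * I by push_cast; ring, norm_mul, norm_I,
            mul_one, norm_real, Real.norm_eq_abs, abs_mul,
            abs_of_pos (by positivity : 0 < 2 * Real.pi)] at hy1
          nlinarith [Real.pi_gt_three]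
        rw [hNN]
      exact DifferentiableAt.congr_of_eventuallyEq (((hk (N x)).differentiableAt
        (isOpen_ball.mem_nhds hrx)).comp x (H.differentiableOn_map.differentiableAt hD)) hev
    · have hre := re_ge_of_mem_Omega (H.map_mem x hx) hrx
      have hne : r x - z₀ ≠ 0 := norm_pos_iff.mp (by linarith [quarter_le_norm_sub hz' hre])
      have hev : K =ᶠ[𝓝 x] fun y => g y / (r y - z₀) := by
        filter_upwards [hD, (hrc.sub continuousAt_const).eventually_ne hne] with y hy hy1
        rw [hmul y hy]
        exact (mul_div_cancel_left₀ _ hy1).symm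
      exact DifferentiableAt.congr_of_eventuallyEq ((hg.differentiableAt hD).div
        ((H.differentiableOn_map.differentiableAt hD).sub_const _) hne) hev
  obtain ⟨K', hK'⟩ := exists_Hinf hdiff (C := ‖κ‖ + ‖G‖ * 4) fun x hx => by
    by_cases hrx : r x ∈ unitDisk
    · simp only [hK, if_pos hrx]
      have h1 := norm_le_of_mem_HinfDiskInt κ ⟨r x, hrx⟩ (N x)
      rw [hκk] at h1
      exact h1.trans (le_add_of_nonneg_right (by positivity))
    · simp only [hK, if_neg hrx]
      have h1 := quarter_le_norm_sub hz' (re_ge_of_mem_Omega (H.map_mem x hx) hrx)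
      have h2 : ‖g x‖ ≤ ‖G‖ := by
        rw [← hGg ⟨x, hx⟩]
        exact (G : unitDisk →ᵇ ℂ).norm_coe_le_norm _
      rw [norm_div, div_le_iff₀ (by linarith)]
      nlinarith [norm_nonneg κ, norm_nonneg G, norm_nonneg (g x)]
  refine ⟨K', Hinf_ext fun x => ?_⟩
  rw [hGg x, hmul x x.2, ← hK']
  simp [hr]

lemma IsSheetModel.norm_char_le (H : IsSheetModel r ℓ q)
    (hr : ∀ z : unitDisk, (ruElem : unitDisk →ᵇ ℂ) z = r z) (ζ : Hinf unitDisk →ₐ[ℂ] ℂ)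
    (hζ : (ζ ruElem).re ≤ 1 / 2) : ‖ζ ruElem‖ ≤ 1 := by
  by_contra! hn
  set z₀ := ζ ruElem with hz₀
  obtain ⟨ε, hε, hεr⟩ : ∃ ε : ℝ, 0 < ε ∧ ∀ x ∈ unitDisk, ε ≤ ‖r x - z₀‖ := by
    refine ⟨min (‖z₀‖ - 1) (1 / 4), lt_min (by linarith) (by norm_num), fun x hx => ?_⟩
    by_cases hrx : r x ∈ unitDisk
    · refine (min_le_left _ _).trans ?_
      rw [norm_sub_rev]
      have := norm_sub_norm_le z₀ (r x)
      rw [mem_ball_zero_iff] at hrx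
      linarith
    · exact (min_le_right _ _).trans
        (quarter_le_norm_sub hζ (re_ge_of_mem_Omega (H.map_mem x hx) hrx))
  have hne : ∀ x ∈ unitDisk, r x - z₀ ≠ 0 := fun x hx =>
    norm_pos_iff.mp (hε.trans_le (hεr x hx))
  obtain ⟨K, hK⟩ := exists_Hinf (g := fun x => (r x - z₀)⁻¹) (C := ε⁻¹)
    ((H.differentiableOn_map.sub_const _).inv hne) fun x hx => by
      rw [norm_inv]
      gcongr
      exact hεr x hx
  have h1 : (ruElem - algebraMap ℂ _ z₀) * K = 1 := Hinf_ext fun x => by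
    have h2 : ((ruElem - algebraMap ℂ _ z₀) * K : Hinf unitDisk).1 x =
      ((ruElem : unitDisk →ᵇ ℂ) x - z₀) * (K : unitDisk →ᵇ ℂ) x := rfl
    rw [h2, hr, hK, mul_inv_cancel₀ (hne x x.2)]
    rfl
  have h3 := congrArg ζ h1
  rw [map_mul, map_sub, AlgHom.commutes, map_one, ← hz₀] at h3
  simp at h3

lemma norm_char_pElem_le (hp : ∀ x : DiskInt, (pElem : DiskInt →ᵇ ℂ) x = (x.1 : ℂ))
    (ξ : characterSpace ℂ HinfDiskInt) : ‖ξ pElem‖ ≤ 1 := by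
  have h1 : ‖(1 : HinfDiskInt)‖ = 1 := norm_one (α := DiskInt →ᵇ ℂ)
  refine (AlgHom.norm_apply_le_self_mul_norm_one (CharacterSpace.equivAlgHom ξ) pElem).trans ?_
  rw [h1, mul_one]
  refine (BoundedContinuousFunction.norm_le zero_le_one).mpr fun x => ?_
  change ‖(pElem : DiskInt →ᵇ ℂ) x‖ ≤ 1
  rw [hp]
  exact (mem_ball_zero_iff.mp x.1.2).le

lemma char_pElem_mem_closure (hp : ∀ x : DiskInt, (pElem : DiskInt →ᵇ ℂ) x = (x.1 : ℂ))
    (ξ : characterSpace ℂ HinfDiskInt) : ξ pElem ∈ closure unitDisk := by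
  rw [closure_ball _ one_ne_zero, mem_closedBall_zero_iff]
  exact norm_char_pElem_le hp ξ

lemma continuous_char_apply {R : Type*} [NormedRing R] [NormedAlgebra ℂ R] (f : R) :
    Continuous fun ξ : characterSpace ℂ R => ξ f :=
  (WeakDual.eval_continuous f).comp continuous_subtype_val

lemma IsSheetModel.nonempty_homeomorph (H : IsSheetModel r ℓ q)
    (hr : ∀ z : unitDisk, (ruElem : unitDisk →ᵇ ℂ) z = r z)
    (hp : ∀ x : DiskInt, (pElem : DiskInt →ᵇ ℂ) x = (x.1 : ℂ)) :
    Nonempty (({ξ : characterSpace ℂ HinfDiskInt |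
          ξ pElem ∈ closure unitDisk ∧ (ξ pElem).re ≤ 1 / 2} : Set _) ≃ₜ
        ({ξ : characterSpace ℂ (Hinf unitDisk) | (ξ ruElem).re ≤ 1 / 2} : Set _)) := by
  set X := {ξ : characterSpace ℂ HinfDiskInt |
    ξ pElem ∈ closure unitDisk ∧ (ξ pElem).re ≤ 1 / 2}
  set Y := {ξ : characterSpace ℂ (Hinf unitDisk) | (ξ ruElem).re ≤ 1 / 2}
  have hX : IsClosed X := (isClosed_closure.preimage (continuous_char_apply pElem)).inter
    (isClosed_le (continuous_re.comp (continuous_char_apply pElem)) continuous_const)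
  have : CompactSpace X := isCompact_iff_compactSpace.mp hX.isCompact
  have hmap : ∀ ξ, charComap H.pullback ξ ruElem = ξ pElem := fun ξ => by
    rw [charComap_apply, H.pullback_map hr hp]
  set Φ : X → Y := fun ξ => ⟨charComap H.pullback ξ, by
    change (charComap H.pullback ξ ruElem).re ≤ 1 / 2
    rw [hmap]
    exact ξ.2.2⟩ with hΦ
  have hΦc : Continuous Φ :=
    ((continuous_charComap _).comp continuous_subtype_val).subtype_mk _
  have hinj : Function.Injective Φ := by
    intro ξ η hξη
    have hval : ∀ g, ξ.1 (H.pullback g) = η.1 (H.pullback g) := fun g => by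
      have := congrArg (fun ζ : Y => ζ.1 g) hξη
      simpa [hΦ] using this
    have hpp : ξ.1 pElem = η.1 pElem := by rw [← H.pullback_map hr hp, hval]
    have hn : ‖ξ.1 pElem‖ ≤ 1 := norm_char_pElem_le hp _
    refine Subtype.ext (WeakDual.CharacterSpace.ext fun f => ?_)
    obtain ⟨G, κ, hG⟩ := H.exists_pullback_eq hr hp hn ξ.2.2 f
    have key : ∀ θ : characterSpace ℂ HinfDiskInt, θ pElem = ξ.1 pElem →
        θ (H.pullback G) = cornerPoly (ξ.1 pElem) * θ f := fun θ hθ => by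
      have h1 := congrArg (CharacterSpace.equivAlgHom θ) hG
      rw [map_add, map_mul, map_mul, map_sub, AlgHom.commutes, map_cornerElem, map_cornerElem,
        H.pullback_map hr hp, cornerElem_complex] at h1
      change θ _ = cornerPoly (θ pElem) * θ f + (θ pElem - ξ.1 pElem) * θ κ at h1
      rw [h1, hθ, sub_self, zero_mul, add_zero]
    have h2 := key ξ.1 rfl
    have h3 := key η.1 hpp.symm
    rw [hval, h3] at h2
    exact (mul_left_cancel₀ (cornerPoly_ne_zero ξ.2.2) h2).symm
  have hsurj : Function.Surjective Φ := by
    rintro ⟨ζ, hζ⟩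
    set ζ' := CharacterSpace.equivAlgHom ζ
    have hζ' : (ζ' ruElem).re ≤ 1 / 2 := hζ
    have hn := H.norm_char_le hr ζ' hζ'
    obtain ⟨η, hη⟩ := exists_character_extension H.pullback ζ' (cornerElem ruElem)
      (pElem - algebraMap ℂ _ (ζ' ruElem))
      (by rw [map_cornerElem]; exact cornerPoly_ne_zero hζ')
      (H.exists_pullback_eq hr hp hn hζ') fun G κ hG => by
        obtain ⟨K, rfl⟩ := H.exists_eq_mul hr hp hζ' hG
        rw [map_mul, map_sub, AlgHom.commutes]
        simp
    have hηp : η pElem = ζ ruElem := by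
      rw [← H.pullback_map hr hp, hη]
      rfl
    refine ⟨⟨CharacterSpace.equivAlgHom.symm η, char_pElem_mem_closure hp _, ?_⟩, ?_⟩
    · change (η pElem).re ≤ 1 / 2
      rw [hηp]
      exact hζ
    · exact Subtype.ext (WeakDual.CharacterSpace.ext fun g => hη g)
  exact ⟨hΦc.homeoOfEquivCompactToT2 (f := Equiv.ofBijective Φ ⟨hinj, hsurj⟩)⟩

lemma neg_mem_unitDisk (z : unitDisk) : -(z : ℂ) ∈ unitDisk := by
  rw [mem_ball_zero_iff, norm_neg]
  exact mem_ball_zero_iff.mp z.2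

/-- The automorphism of `HinfDiskInt` induced by `z ↦ -z`. -/
def reflectDiskInt : HinfDiskInt →ₐ[ℂ] HinfDiskInt where
  toFun F := ⟨(F : DiskInt →ᵇ ℂ).compContinuous
    ⟨fun x : DiskInt => ((⟨-x.1, neg_mem_unitDisk x.1⟩ : unitDisk), x.2),
      (Continuous.subtype_mk (by fun_prop) _).prodMk continuous_snd⟩, fun n => by
    obtain ⟨g, hg, hFg⟩ := F.2 n
    exact ⟨fun z => g (-z), hg.comp differentiableOn_id.neg fun z hz => by simpa using hz,
      fun z => hFg _⟩⟩
  map_one' := rfl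
  map_mul' _ _ := rfl
  map_zero' := rfl
  map_add' _ _ := rfl
  commutes' _ := rfl

lemma reflectDiskInt_reflectDiskInt (F : HinfDiskInt) : reflectDiskInt (reflectDiskInt F) = F :=
  HinfDiskInt_ext fun z n => by
    have h : (⟨- -(z : ℂ), neg_mem_unitDisk ⟨_, neg_mem_unitDisk z⟩⟩ : unitDisk) = z :=
      Subtype.ext (neg_neg _)
    exact congrArg (fun w => (F : DiskInt →ᵇ ℂ) (w, n)) h

lemma reflectDiskInt_pElem (hp : ∀ x : DiskInt, (pElem : DiskInt →ᵇ ℂ) x = (x.1 : ℂ)) :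
    reflectDiskInt pElem = -pElem :=
  HinfDiskInt_ext fun z n => by
    have h1 := hp (⟨-z, neg_mem_unitDisk z⟩, n)
    have h2 := congrArg Neg.neg (hp (z, n))
    exact h1.trans h2.symm

lemma nonempty_homeomorph_reflect
    (hp : ∀ x : DiskInt, (pElem : DiskInt →ᵇ ℂ) x = (x.1 : ℂ)) :
    Nonempty (({ξ : characterSpace ℂ HinfDiskInt |
          ξ pElem ∈ closure unitDisk ∧ -(1 / 2) ≤ (ξ pElem).re} : Set _) ≃ₜ
        ({ξ : characterSpace ℂ HinfDiskInt |
          ξ pElem ∈ closure unitDisk ∧ (ξ pElem).re ≤ 1 / 2} : Set _)) := by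
  have hinv : ∀ ξ, charComap reflectDiskInt (charComap reflectDiskInt ξ) = ξ := fun ξ =>
    WeakDual.CharacterSpace.ext fun f => by
      rw [charComap_apply, charComap_apply, reflectDiskInt_reflectDiskInt]
  have hneg : ∀ ξ, charComap reflectDiskInt ξ pElem = -ξ pElem := fun ξ => by
    rw [charComap_apply, reflectDiskInt_pElem hp, map_neg]
  refine ⟨{ toFun := fun ξ => ⟨charComap reflectDiskInt ξ, char_pElem_mem_closure hp _, ?_⟩
            invFun := fun ξ => ⟨charComap reflectDiskInt ξ, char_pElem_mem_closure hp _, ?_⟩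
            left_inv := fun ξ => Subtype.ext (hinv _)
            right_inv := fun ξ => Subtype.ext (hinv _)
            continuous_toFun :=
              ((continuous_charComap _).comp continuous_subtype_val).subtype_mk _
            continuous_invFun :=
              ((continuous_charComap _).comp continuous_subtype_val).subtype_mk _ }⟩
  · rw [hneg, neg_re]
    linarith [ξ.2.2]
  · rw [hneg, neg_re]
    linarith [ξ.2.2]

end SheetAlgebra

lemma eq_of_exp_eq_one {X : Type*} [TopologicalSpace X] [PreconnectedSpace X] {f : X → ℂ}
    (hf : Continuous f) (hexp : ∀ x, cexp (f x) = 1) (x y : X) : f x = f y := by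
  have hint : ∀ x, ∃ n : ℤ, f x = n * (2 * Real.pi * I) := fun x =>
    Complex.exp_eq_one_iff.1 (hexp x)
  choose n hn using hint
  have hcast : (fun x => ((n x : ℤ) : ℝ)) = fun x => (f x / (2 * Real.pi * I)).re := by
    ext x
    rw [hn x, mul_div_cancel_right₀ _ Complex.two_pi_I_ne_zero, Complex.intCast_re]
  have hcont : Continuous n := by
    rw [Int.isClosedEmbedding_coe_real.isEmbedding.continuous_iff]
    change Continuous fun x => ((n x : ℤ) : ℝ)
    rw [hcast]
    exact Complex.continuous_re.comp (hf.div_const _)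
  have hxy : n x = n y := PreconnectedSpace.constant inferInstance hcont
  rw [hn x, hn y, hxy]

lemma exists_holomorphic_log {f : ℂ → ℂ} (hf : DifferentiableOn ℂ f unitDisk)
    (h0 : ∀ z ∈ unitDisk, f z ≠ 0) :
    ∃ ℓ : ℂ → ℂ, DifferentiableOn ℂ ℓ unitDisk ∧ ∀ z ∈ unitDisk, cexp (ℓ z) = f z := by
  have hquot : DifferentiableOn ℂ (fun z => deriv f z / f z) unitDisk :=
    (hf.deriv isOpen_ball).div hf h0
  have hmem : (0 : ℂ) ∈ unitDisk := mem_ball_self one_pos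
  obtain ⟨ℓ, hℓ0, hℓ⟩ := hquot.isExactOn_ball.with_val_at 0 (Complex.log (f 0))
  have hℓd : DifferentiableOn ℂ ℓ unitDisk := fun z hz =>
    (hℓ z hz).differentiableAt.differentiableWithinAt
  refine ⟨ℓ, hℓd, fun z hz => ?_⟩
  have hder : ∀ w ∈ unitDisk, HasDerivAt (fun w => cexp (-ℓ w) * f w) 0 w := by
    intro w hw
    have hfw := (hf.differentiableAt (isOpen_ball.mem_nhds hw)).hasDerivAt
    refine (((hℓ w hw).neg.cexp).mul hfw).congr_deriv ?_
    field_simp [h0 w hw]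
    ring
  have hconst := isOpen_ball.is_const_of_deriv_eq_zero
    (convex_ball (0 : ℂ) 1).isPreconnected
    (fun w hw => (hder w hw).differentiableAt.differentiableWithinAt)
    (fun w hw => (hder w hw).deriv) hz hmem
  simp only [hℓ0, Complex.exp_neg, Complex.exp_log (h0 0 hmem),
    inv_mul_cancel₀ (h0 0 hmem)] at hconst
  rwa [inv_mul_eq_one₀ (Complex.exp_ne_zero _)] at hconst

lemma differentiableOn_of_continuousOn_section {r s : ℂ → ℂ}
    (hr : DifferentiableOn ℂ r unitDisk) (hs : ContinuousOn s unitDisk)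
    (hmem : ∀ z ∈ unitDisk, s z ∈ unitDisk) (hrs : ∀ z ∈ unitDisk, r (s z) = z) :
    DifferentiableOn ℂ s unitDisk := by
  have hregular : ∀ z ∈ unitDisk, deriv r (s z) ≠ 0 → DifferentiableAt ℂ s z := by
    intro z hz hd
    refine (HasDerivAt.of_local_left_inverse (hs.continuousAt (isOpen_ball.mem_nhds hz))
      (hr.differentiableAt (isOpen_ball.mem_nhds (hmem z hz))).hasDerivAt hd ?_).differentiableAt
    filter_upwards [isOpen_ball.mem_nhds hz] with w hw using hrs w hw
  intro z hz
  have hcont : ContinuousAt s z := hs.continuousAt (isOpen_ball.mem_nhds hz)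
  have han : AnalyticAt ℂ (deriv r) (s z) :=
    (hr.deriv isOpen_ball).analyticAt (isOpen_ball.mem_nhds (hmem z hz))
  refine (Complex.analyticAt_of_differentiable_on_punctured_nhds_of_continuousAt ?_
    hcont).differentiableAt.differentiableWithinAt
  have hdisk : ∀ᶠ w in 𝓝[≠] z, w ∈ unitDisk :=
    nhdsWithin_le_nhds (isOpen_ball.mem_nhds hz)
  rcases han.eventually_eq_zero_or_eventually_ne_zero with h | h
  · exfalso
    obtain ⟨ε, hε, hball⟩ := Metric.eventually_nhds_iff_ball.1
      (h.and (isOpen_ball.eventually_mem (hmem z hz)))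
    have hconst : ∀ w ∈ ball (s z) ε, r w = r (s z) := fun w hw =>
      isOpen_ball.is_const_of_deriv_eq_zero (convex_ball (s z) ε).isPreconnected
        (hr.mono fun w hw => (hball w hw).2) (fun w hw => (hball w hw).1) hw
        (mem_ball_self hε)
    have hnear : ∀ᶠ w in 𝓝[≠] z, s w ∈ ball (s z) ε :=
      nhdsWithin_le_nhds (hcont.eventually (ball_mem_nhds _ hε))
    obtain ⟨w, hwz, hwD, hw⟩ :=
      ((eventually_mem_nhdsWithin (a := z) (s := {z}ᶜ)).and (hdisk.and hnear)).exists
    exact hwz (by rw [mem_singleton_iff, ← hrs w hwD, ← hrs z hz, hconst _ hw])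
  · have hne : ∀ᶠ w in 𝓝[≠] z, s w ≠ s z := by
      filter_upwards [hdisk, eventually_mem_nhdsWithin] with w hwD hwz heq
      exact hwz (by rw [mem_singleton_iff, ← hrs w hwD, ← hrs z hz, heq])
    have htend : Filter.Tendsto s (𝓝[≠] z) (𝓝[≠] s z) :=
      tendsto_nhdsWithin_iff.2 ⟨hcont.tendsto.mono_left nhdsWithin_le_nhds, hne⟩
    filter_upwards [hdisk, htend.eventually h] with w hwD hw using hregular w hwD hw

lemma exists_holomorphic_section {r : ℂ → ℂ} (hr : DifferentiableOn ℂ r unitDisk)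
    (himage : r '' unitDisk = Omega)
    (hcov : IsCoveringMapOn (fun z : unitDisk => r z) Omega) :
    ∃ s : ℂ → ℂ, DifferentiableOn ℂ s unitDisk ∧ (∀ z ∈ unitDisk, s z ∈ unitDisk) ∧
      ∀ z ∈ unitDisk, r (s z) = z := by
  have hsub : ∀ z ∈ unitDisk, z ∈ Omega := by
    refine fun z hz => ⟨Or.inl hz, fun h => ?_⟩
    rw [mem_singleton_iff.1 h] at hz
    norm_num [unitDisk] at hz
  have hmem : (0 : ℂ) ∈ unitDisk := mem_ball_self one_pos
  obtain ⟨x₀, hx₀, hrx₀⟩ : (0 : ℂ) ∈ r '' unitDisk := himage ▸ hsub 0 hmem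
  have : ContractibleSpace unitDisk :=
    (convex_ball (0 : ℂ) 1).contractibleSpace ⟨0, hmem⟩
  have : LocallyPathConnectedSpace unitDisk := isOpen_ball.locallyPathConnectedSpace
  obtain ⟨F, ⟨-, hF⟩, -⟩ := hcov.existsUnique_continuousMap_lifts
    ⟨fun z : unitDisk => (z : ℂ), continuous_subtype_val⟩ (a₀ := ⟨0, hmem⟩) (e₀ := ⟨x₀, hx₀⟩)
    hrx₀ fun z => hsub z z.2
  classical
  let s : ℂ → ℂ := fun z => if hz : z ∈ unitDisk then F ⟨z, hz⟩ else 0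
  have hsF : ∀ z : unitDisk, s z = F z := fun z => dif_pos z.2
  have hmap : ∀ z ∈ unitDisk, s z ∈ unitDisk := fun z hz => by
    rw [hsF ⟨z, hz⟩]
    exact (F ⟨z, hz⟩).2
  have hsec : ∀ z ∈ unitDisk, r (s z) = z := fun z hz => by
    rw [hsF ⟨z, hz⟩]
    exact congrFun hF ⟨z, hz⟩
  refine ⟨s, differentiableOn_of_continuousOn_section hr ?_ hmap hsec, hmap, hsec⟩
  rw [continuousOn_iff_continuous_domRestrict]
  exact (continuous_subtype_val.comp F.continuous).congr fun z => (hsF z).symm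

lemma differentiableOn_moebius {f : ℂ → ℂ} {a b c d : ℂ} (hdet : a * d - b * c ≠ 0)
    (hf : ∀ z ∈ unitDisk, f z = (a * z + b) / (c * z + d))
    (hmem : ∀ z ∈ unitDisk, f z ∈ unitDisk) : DifferentiableOn ℂ f unitDisk := by
  have hden : ∀ z ∈ unitDisk, c * z + d ≠ 0 := by
    intro z hz hzero
    have hd : d = -(c * z) := by linear_combination hzero
    have hc : c ≠ 0 := by
      rintro rfl
      simp [hd] at hdet
    have hle : ∀ᶠ w in 𝓝[≠] z, ‖a * w + b‖ ≤ ‖c * w + d‖ := by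
      have hdisk : ∀ᶠ w in 𝓝[≠] z, w ∈ unitDisk :=
        nhdsWithin_le_nhds (isOpen_ball.mem_nhds hz)
      filter_upwards [hdisk, eventually_mem_nhdsWithin] with w hw hwz
      have hne : c * w + d ≠ 0 := by
        rw [hd, show c * w + -(c * z) = c * (w - z) by ring]
        exact mul_ne_zero hc (sub_ne_zero.2 hwz)
      have hlt := hmem w hw
      rw [hf w hw, mem_ball_zero_iff, norm_div, div_lt_one (norm_pos_iff.2 hne)] at hlt
      exact hlt.le
    have hl : Continuous fun w : ℂ => ‖a * w + b‖ := by fun_prop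
    have hr : Continuous fun w : ℂ => ‖c * w + d‖ := by fun_prop
    have hlim := le_of_tendsto_of_tendsto (hl.continuousAt.tendsto.mono_left nhdsWithin_le_nhds)
      (hr.continuousAt.tendsto.mono_left nhdsWithin_le_nhds) hle
    rw [hzero, norm_zero, norm_le_zero_iff] at hlim
    exact hdet (by linear_combination (-c) * hlim + a * hzero)
  refine DifferentiableOn.congr ?_ hf
  exact DifferentiableOn.div (by fun_prop) (by fun_prop) hden

/-- Lifting a loop around the puncture `3 / 2` of `Ω` through a covering map increases the
logarithm of `3 / 2 - r` by `2 π i`. -/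
lemma exists_log_eq_add_two_pi_I {r ℓ : ℂ → ℂ} (himage : r '' unitDisk = Omega)
    (hcov : IsCoveringMapOn (fun z : unitDisk => r z) Omega)
    (hℓ : ContinuousOn ℓ unitDisk) (hexp : ∀ z ∈ unitDisk, cexp (ℓ z) = 3 / 2 - r z) :
    ∃ x ∈ unitDisk, ∃ y ∈ unitDisk, r x = r y ∧ ℓ y = ℓ x + 2 * Real.pi * I := by
  let γ : C(ℝ, ℂ) := ⟨fun t => 3 / 2 - 1 / 2 * cexp (2 * Real.pi * I * t), by fun_prop⟩
  have hnorm : ∀ t : ℝ, ‖cexp (2 * Real.pi * I * t)‖ = 1 := fun t => by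
    rw [show (2 * Real.pi * I * t : ℂ) = ((2 * Real.pi * t : ℝ) : ℂ) * I by push_cast; ring]
    exact Complex.norm_exp_ofReal_mul_I _
  have hγ : ∀ t, γ t ∈ Omega := by
    refine fun t => ⟨Or.inr ?_, fun h => ?_⟩
    · rw [mem_ball, dist_eq_norm]
      simp only [γ, ContinuousMap.coe_mk, sub_sub_cancel_left, norm_neg, norm_mul, hnorm]
      norm_num
    · simp [γ] at h
  obtain ⟨x₀, hx₀, hrx₀⟩ : γ 0 ∈ r '' unitDisk := himage ▸ hγ 0
  obtain ⟨Γ, -, hΓ⟩ := (hcov.existsUnique_continuousMap_lifts γ (a₀ := 0) (e₀ := ⟨x₀, hx₀⟩)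
    hrx₀ hγ).exists
  have hrΓ : ∀ t, r (Γ t) = γ t := fun t => congrFun hΓ t
  have hcont : Continuous fun t : ℝ => ℓ (Γ t) :=
    hℓ.comp_continuous (continuous_subtype_val.comp Γ.continuous) fun t => (Γ t).2
  have hconst := eq_of_exp_eq_one
    (f := fun t : ℝ => ℓ (Γ t) - Complex.log (1 / 2) - 2 * Real.pi * I * t)
    ((hcont.sub continuous_const).sub (by fun_prop)) (fun t => by
      rw [Complex.exp_sub, Complex.exp_sub, hexp _ (Γ t).2, hrΓ, Complex.exp_log (by norm_num)]
      simp only [γ, ContinuousMap.coe_mk, sub_sub_cancel]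
      field_simp [Complex.exp_ne_zero]) 1 0
  refine ⟨Γ 0, (Γ 0).2, Γ 1, (Γ 1).2, ?_, ?_⟩
  · rw [hrΓ, hrΓ]
    simp [γ]
  · push_cast at hconst
    linear_combination hconst

lemma exists_isSheetModel {r : ℂ → ℂ} (hr : DifferentiableOn ℂ r unitDisk)
    (himage : r '' unitDisk = Omega)
    (hcov : IsCoveringMapOn (fun z : unitDisk => r z) Omega) {A : ℤ → ℂ → ℂ}
    (hA : ∀ n, DifferentiableOn ℂ (A n) unitDisk)
    (hAmem : ∀ n : ℤ, ∀ z ∈ unitDisk, A n z ∈ unitDisk)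
    (hAadd : ∀ m n : ℤ, ∀ z ∈ unitDisk, A m (A n z) = A (m + n) z)
    (hAdeck : ∀ n : ℤ, ∀ z ∈ unitDisk, r (A n z) = r z)
    (hAtrans : ∀ z ∈ unitDisk, ∀ w ∈ unitDisk, r z = r w → ∃ n : ℤ, w = A n z) :
    ∃ ℓ q, IsSheetModel r ℓ q := by
  have hmem : (0 : ℂ) ∈ unitDisk := mem_ball_self one_pos
  have hmap : ∀ x ∈ unitDisk, r x ∈ Omega := fun x hx => himage ▸ mem_image_of_mem r hx
  obtain ⟨s, hs, hsmem, hrs⟩ := exists_holomorphic_section hr himage hcov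
  obtain ⟨ℓ₀, hℓ₀, hexp₀⟩ := exists_holomorphic_log (f := fun z => 3 / 2 - r z)
    (hr.const_sub _) fun z hz => sub_ne_zero.2 fun h => (hmap z hz).2 h.symm
  have : PreconnectedSpace unitDisk :=
    Subtype.preconnectedSpace (convex_ball (0 : ℂ) 1).isPreconnected
  have hslit : ∀ z ∈ unitDisk, 3 / 2 - z ∈ slitPlane := fun z hz =>
    Or.inl (by linarith [half_le_re_sub (mem_ball_zero_iff.1 hz).le])
  -- `ℓ₀` differs by a constant from the principal logarithm on the section and from its
  -- translates by the deck group
  have hseccont : ContinuousOn (fun z => ℓ₀ (s z) - Complex.log (3 / 2 - z)) unitDisk :=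
    (hℓ₀.continuousOn.comp hs.continuousOn hsmem).sub
      (ContinuousOn.clog (by fun_prop) hslit)
  have hsec : ∀ z : unitDisk, ∃ c : ℂ, cexp c = 1 ∧
      ℓ₀ (s z) - Complex.log (3 / 2 - z) = c := by
    refine fun z => ⟨_, ?_, rfl⟩
    rw [Complex.exp_sub, hexp₀ _ (hsmem z z.2), hrs z z.2,
      Complex.exp_log (slitPlane_ne_zero (hslit z z.2)),
      div_self (slitPlane_ne_zero (hslit z z.2))]
  obtain ⟨c₀, hc₀, hℓs⟩ : ∃ c₀ : ℂ, cexp c₀ = 1 ∧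
      ∀ z ∈ unitDisk, ℓ₀ (s z) = Complex.log (3 / 2 - z) + c₀ := by
    obtain ⟨c, hc, hc'⟩ := hsec ⟨0, hmem⟩
    refine ⟨c, hc, fun z hz => ?_⟩
    have := eq_of_exp_eq_one (continuousOn_iff_continuous_domRestrict.1 hseccont)
      (fun w => by
        obtain ⟨c, hc, hc'⟩ := hsec w
        exact (congrArg cexp hc').trans hc) ⟨z, hz⟩ ⟨0, hmem⟩
    have h2 := this.trans hc'
    simp only [Set.domRestrict_apply] at h2
    linear_combination h2
  have hdeck : ∀ n : ℤ, ∃ m : ℤ, ∀ z ∈ unitDisk, ℓ₀ (A n z) = ℓ₀ z + m * (2 * Real.pi * I) := by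
    intro n
    have hcont : ContinuousOn (fun z => ℓ₀ (A n z) - ℓ₀ z) unitDisk :=
      (hℓ₀.continuousOn.comp (hA n).continuousOn (hAmem n)).sub hℓ₀.continuousOn
    have hone : ∀ z ∈ unitDisk, cexp (ℓ₀ (A n z) - ℓ₀ z) = 1 := fun z hz => by
      have hz' := hexp₀ _ (hAmem n z hz)
      rw [hAdeck n z hz, ← hexp₀ z hz] at hz'
      rw [Complex.exp_sub, hz', div_self (Complex.exp_ne_zero _)]
    obtain ⟨m, hm⟩ := Complex.exp_eq_one_iff.1 (hone 0 hmem)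
    refine ⟨m, fun z hz => ?_⟩
    have := eq_of_exp_eq_one (continuousOn_iff_continuous_domRestrict.1 hcont)
      (fun w => hone w w.2) ⟨z, hz⟩ ⟨0, hmem⟩
    simp only [Set.domRestrict_apply] at this
    linear_combination this + hm
  choose d hd using hdeck
  have hdadd : ∀ m n, d (m + n) = d m + d n := by
    intro m n
    have h := hd (m + n) 0 hmem
    rw [← hAadd m n 0 hmem, hd m _ (hAmem n 0 hmem), hd n 0 hmem] at h
    have : ((d (m + n) : ℤ) : ℂ) = d m + d n :=
      mul_right_cancel₀ Complex.two_pi_I_ne_zero (by linear_combination -h)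
    exact_mod_cast this
  have hdmul : ∀ n : ℤ, d n = n * d 1 := fun n => by
    simpa using map_zsmul (AddMonoidHom.mk' d hdadd) n 1
  obtain ⟨x, hx, y, hy, hxy, hℓxy⟩ :=
    exists_log_eq_add_two_pi_I himage hcov hℓ₀.continuousOn hexp₀
  obtain ⟨k, rfl⟩ := hAtrans x hx y hy hxy
  have hk : k * d 1 = 1 := by
    rw [← hdmul]
    have : ((d k : ℤ) : ℂ) = 1 :=
      mul_right_cancel₀ Complex.two_pi_I_ne_zero (by linear_combination hℓxy - hd k x hx)
    exact_mod_cast this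
  refine ⟨fun x => ℓ₀ x - c₀, fun n z => A (n * k) (s z), hr, hmap, hℓ₀.sub_const _, ?_, ?_, ?_,
    ?_, ?_, ?_⟩
  · intro x hx
    rw [Complex.exp_sub, hc₀, div_one, hexp₀ x hx]
  · exact fun n => (hA _).comp hs hsmem
  · exact fun n z hz => hAmem _ _ (hsmem z hz)
  · exact fun n z hz => by rw [hAdeck _ _ (hsmem z hz), hrs z hz]
  · intro n z hz
    rw [hd _ _ (hsmem z hz), hℓs z hz, hdmul, mul_assoc, hk]
    push_cast
    ring
  · intro x hx hrx
    obtain ⟨n, hn⟩ := hAtrans _ (hsmem _ hrx) x hx (hrs _ hrx)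
    refine ⟨n * d 1, ?_⟩
    rw [mul_assoc, mul_comm (d 1), hk, mul_one, ← hn]

/-- Let `r_u : 𝔻 → Ω` be the universal covering of
`Ω = (𝔻 ∪ 𝔻₁(3/2)) \ {3/2}` and let `r̂_u` be the Gelfand extension of `r_u ∈ H^∞(𝔻)`;
set `Ṽ := {ξ ∈ 𝔐(H^∞(𝔻)) : Re r̂_u(ξ) ≤ 1/2}`.  Let `p : 𝔻 × ℤ → 𝔻` be the projection
`(z, n) ↦ z` and `p̂ : 𝔐(H^∞(𝔻 × ℤ)) → 𝔻̄` its Gelfand extension, and set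
`S := {z ∈ 𝔻̄ : Re z ≤ 1/2}`, `S_o := {z ∈ 𝔻̄ : Re z ≥ -1/2}`.  Then `p̂⁻¹(S)` and
`p̂⁻¹(S_o)` are each homeomorphic to the compact set `Ṽ`, and
`𝔐(H^∞(𝔻 × ℤ)) = p̂⁻¹(S) ∪ p̂⁻¹(S_o)`. -/
theorem maxIdealSpace_diskInt_decomposition
    (r_u : ℂ → ℂ)
    (hdiff : DifferentiableOn ℂ r_u unitDisk)
    (himage : r_u '' unitDisk = Omega)
    (hcov : IsCoveringMapOn (fun z : unitDisk => r_u z) Omega)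
    (A : ℤ → ℂ → ℂ)
    (hA0 : ∀ z ∈ unitDisk, A 0 z = z)
    (hAadd : ∀ m n : ℤ, ∀ z ∈ unitDisk, A m (A n z) = A (m + n) z)
    (hAimage : ∀ n : ℤ, A n '' unitDisk = unitDisk)
    (hAmob : ∀ n : ℤ, ∃ a b c d : ℂ, a * d - b * c ≠ 0 ∧
      ∀ z ∈ unitDisk, A n z = (a * z + b) / (c * z + d))
    (hAdeck : ∀ n : ℤ, ∀ z ∈ unitDisk, r_u (A n z) = r_u z)
    (hAfree : ∀ n : ℤ, n ≠ 0 → ∀ z ∈ unitDisk, A n z ≠ z)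
    (hAtrans : ∀ z ∈ unitDisk, ∀ w ∈ unitDisk, r_u z = r_u w → ∃ n : ℤ, w = A n z)
    -- `r_u`, regarded as an element of `H^∞(𝔻)`
    (ruElem : Hinf unitDisk)
    (hruElem : ∀ z : unitDisk, (ruElem : unitDisk →ᵇ ℂ) z = r_u z)
    -- the projection `p (z, n) = z`, regarded as an element of `H^∞(𝔻 × ℤ)`
    (pElem : HinfDiskInt)
    (hpElem : ∀ x : DiskInt, (pElem : DiskInt →ᵇ ℂ) x = (x.1 : ℂ)) :
    IsCompact {ξ : characterSpace ℂ (Hinf unitDisk) | (ξ ruElem).re ≤ 1 / 2} ∧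
    Nonempty
      (({ξ : characterSpace ℂ HinfDiskInt |
          ξ pElem ∈ closure unitDisk ∧ (ξ pElem).re ≤ 1 / 2} : Set _) ≃ₜ
        ({ξ : characterSpace ℂ (Hinf unitDisk) | (ξ ruElem).re ≤ 1 / 2} : Set _)) ∧
    Nonempty
      (({ξ : characterSpace ℂ HinfDiskInt |
          ξ pElem ∈ closure unitDisk ∧ -(1 / 2) ≤ (ξ pElem).re} : Set _) ≃ₜ
        ({ξ : characterSpace ℂ (Hinf unitDisk) | (ξ ruElem).re ≤ 1 / 2} : Set _)) ∧
    {ξ : characterSpace ℂ HinfDiskInt | ξ pElem ∈ closure unitDisk ∧ (ξ pElem).re ≤ 1 / 2} ∪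
      {ξ : characterSpace ℂ HinfDiskInt |
        ξ pElem ∈ closure unitDisk ∧ -(1 / 2) ≤ (ξ pElem).re} = Set.univ := by
  have hAmem : ∀ n : ℤ, ∀ z ∈ unitDisk, A n z ∈ unitDisk := fun n z hz =>
    hAimage n ▸ mem_image_of_mem (A n) hz
  have hA : ∀ n, DifferentiableOn ℂ (A n) unitDisk := by
    intro n
    obtain ⟨a, b, c, d, hdet, hmob⟩ := hAmob n
    exact differentiableOn_moebius hdet hmob (hAmem n)
  obtain ⟨ℓ, q, H⟩ := exists_isSheetModel hdiff himage hcov hA hAmem hAadd hAdeck hAtrans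
  refine ⟨(isClosed_le (Complex.continuous_re.comp (continuous_char_apply _))
    continuous_const).isCompact, ?_⟩
  obtain ⟨e⟩ := H.nonempty_homeomorph hruElem hpElem
  obtain ⟨e'⟩ := nonempty_homeomorph_reflect hpElem
  refine ⟨⟨e⟩, ⟨e'.trans e⟩, eq_univ_of_forall fun ξ => ?_⟩
  have hξ := char_pElem_mem_closure hpElem ξ
  rcases le_total (ξ pElem).re (1 / 2) with h | h
  · exact Or.inl ⟨hξ, h⟩
  · exact Or.inr ⟨hξ, by linarith⟩

end
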